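/- arXiv:1407.6178 — 5 statements merged into one kernel-verified Lean document; each statement's English description precedes it below -/
import Mathlib

section
/- Let G = (V,E) be a strongly connected finite simple directed graph. Then the 2-edge blocks of G are pairwise disjoint: any two distinct 2-edge blocks have empty intersection. -/
variable {V : Type*}

/-- `p` is a simple directed path from `x` to `y` w.r.t. the edge relation `E`. -/
def IsDipath (E : V → V → Prop) (x y : V) (p : List V) : Prop :=
  List.Chain' E p ∧ p.head? = some x ∧ p.getLast? = some y ∧ p.Nodup

/-- The edges of a path, as the list of consecutive pairs. -/
def dipathEdges (p : List V) : List (V × V) := p.zip p.tail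

/-- There are two (distinct, internally vertex-disjoint) paths from `x` to `y`:
they share no vertices other than `x` and `y`. -/
def TwoVDP (E : V → V → Prop) (x y : V) : Prop :=
  ∃ p q : List V, IsDipath E x y p ∧ IsDipath E x y q ∧ p ≠ q ∧
    ∀ z, z ∈ p → z ∈ q → z = x ∨ z = y

/-- There are two edge-disjoint paths from `x` to `y`. -/
def TwoEDP (E : V → V → Prop) (x y : V) : Prop :=
  ∃ p q : List V, IsDipath E x y p ∧ IsDipath E x y q ∧
    ∀ e, e ∈ dipathEdges p → e ∉ dipathEdges q

/-- Reachability in a digraph. -/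
def DiReach (E : V → V → Prop) (x y : V) : Prop := Relation.ReflTransGen E x y

/-- `x` and `y` lie in the same strongly connected component. -/
def InSameSCC (E : V → V → Prop) (x y : V) : Prop := DiReach E x y ∧ DiReach E y x

/-- The digraph is strongly connected. -/
def IsStronglyConn (E : V → V → Prop) : Prop := ∀ x y, DiReach E x y

/-- Deleting a vertex `w` (and its incident edges). -/
def DelVertex (E : V → V → Prop) (w : V) : V → V → Prop :=
  fun a b => E a b ∧ a ≠ w ∧ b ≠ w

/-- `x ↔² y` : two vertex-disjoint paths in both directions. -/
def Rel2d (E : V → V → Prop) (x y : V) : Prop :=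
  x ≠ y ∧ TwoVDP E x y ∧ TwoVDP E y x

/-- `x ↔^{2s} y`. -/
def Rel2s (E : V → V → Prop) (x y : V) : Prop :=
  x ≠ y ∧ ∀ z, z ≠ x → z ≠ y → InSameSCC (DelVertex E z) x y

/-- `x ↔^{2e} y` : two edge-disjoint paths in both directions. -/
def Rel2e (E : V → V → Prop) (x y : V) : Prop :=
  x ≠ y ∧ TwoEDP E x y ∧ TwoEDP E y x

/-- A maximal vertex set of size ≥ `k` all of whose pairs of distinct elements
satisfy the relation `R` (e.g. a 2-directed/2-strong/2-edge block). -/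
def IsMaxBlock (R : V → V → Prop) (k : ℕ) (C : Set V) : Prop :=
  k ≤ C.ncard ∧ (∀ x ∈ C, ∀ y ∈ C, x ≠ y → R x y) ∧
    ∀ D : Set V, C ⊆ D → (∀ x ∈ D, ∀ y ∈ D, x ≠ y → R x y) → D = C

open Classical in
/-- Divergence contribution of one edge. -/
noncomputable def dEdge {V : Type*} (e : V × V) (v : V) : ℤ :=
  (if e.1 = v then 1 else 0) - (if e.2 = v then 1 else 0)

/-- Divergence of an edge set. -/
noncomputable def dvg {V : Type*} (F : Finset (V × V)) (v : V) : ℤ := ∑ e ∈ F, dEdge e v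

theorem dipathEdges_cons {V : Type*} (a b : V) (t : List V) :
    dipathEdges (a :: b :: t) = (a, b) :: dipathEdges (b :: t) := rfl

theorem chain_iff_edges {V : Type*} (R : V → V → Prop) (p : List V) :
    List.IsChain R p ↔ ∀ e ∈ dipathEdges p, R e.1 e.2 := by
  induction p with
  | nil => simp [dipathEdges]
  | cons a t ih =>
    cases t with
    | nil => simp [dipathEdges]
    | cons b t =>
      rw [dipathEdges_cons, List.isChain_cons_cons, ih]
      simp

theorem fst_mem_of_edge {V : Type*} (p : List V) (e : V × V) (h : e ∈ dipathEdges p) :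
    e.1 ∈ p := by
  obtain ⟨a, b⟩ := e
  exact (List.of_mem_zip h).1

theorem exists_dipath {V : Type*} (R : V → V → Prop) (x z : V)
    (h : Relation.ReflTransGen R x z) : ∃ p, IsDipath R x z p := by
  induction h using Relation.ReflTransGen.head_induction_on with
  | refl => exact ⟨[z], List.isChain_singleton z, by simp⟩
  | head hab hbz ih =>
    rename_i a b
    obtain ⟨p, hc, hh, hl, hn⟩ := ih
    by_cases ha : a ∈ p
    · obtain ⟨s, t, rfl⟩ := List.append_of_mem ha
      refine ⟨a :: t, ?_, rfl, ?_, ?_⟩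
      · exact (List.isChain_append.1 hc).2.1
      · simpa [List.getLast?_append] using hl
      · exact (List.nodup_append.1 hn).2.1
    · cases p with
      | nil => simp at hh
      | cons c t =>
        simp at hh
        subst hh
        refine ⟨a :: c :: t, ?_, rfl, ?_, ?_⟩
        · exact List.isChain_cons_cons.2 ⟨hab, hc⟩
        · simpa using hl
        · exact List.nodup_cons.2 ⟨ha, hn⟩

theorem reach_of_dipath {V : Type*} (R : V → V → Prop) (z : V) (p : List V) :
    ∀ x, List.IsChain R p → p.head? = some x → p.getLast? = some z →
      Relation.ReflTransGen R x z := by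
  induction p with
  | nil => intro x _ h; simp at h
  | cons a t ih =>
    intro x hc hh hl
    simp at hh
    subst hh
    cases t with
    | nil => simp at hl; subst hl; exact .refl
    | cons b t =>
      rw [List.isChain_cons_cons] at hc
      exact .head hc.1 (ih b hc.2 rfl (by simpa using hl))

open Classical in
theorem dvg_path {V : Type*} (z : V) (p : List V) :
    ∀ x, p.Nodup → p.head? = some x → p.getLast? = some z →
      ∀ v, dvg (dipathEdges p).toFinset v = dEdge (x, z) v := by
  induction p with
  | nil => intro x _ h; simp at h
  | cons a t ih =>
    intro x hn hh hl v
    simp at hh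
    subst hh
    cases t with
    | nil => simp at hl; subst hl; simp [dipathEdges, dvg, dEdge]
    | cons b t =>
      rw [List.nodup_cons] at hn
      have := ih b hn.2 rfl (by simpa using hl) v
      rw [dipathEdges_cons, List.toFinset_cons, dvg, Finset.sum_insert, ← dvg, this]
      · simp [dEdge]
      · intro hm
        exact hn.1 (fst_mem_of_edge _ _ (List.mem_toFinset.1 hm))

open Classical in
theorem sum_dvg {V : Type*} (F : Finset (V × V)) (S : Finset V) :
    ∑ v ∈ S, dvg F v = ∑ e ∈ F, ((if e.1 ∈ S then 1 else 0) - (if e.2 ∈ S then 1 else 0) : ℤ) := by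
  unfold dvg
  rw [Finset.sum_comm]
  refine Finset.sum_congr rfl fun e _ => ?_
  simp [dEdge, Finset.sum_sub_distrib]

open Classical in
theorem sum_dEdge {V : Type*} (k : ℤ) (x z : V) (S : Finset V) (hx : x ∈ S) (hz : z ∉ S) :
    ∑ v ∈ S, k * dEdge (x, z) v = k := by
  rw [← Finset.mul_sum]
  simp [dEdge, Finset.sum_sub_distrib, hx, hz]

open Classical in
theorem reach_of_flow {V : Type*} [Fintype V] (F : Finset (V × V)) (k : ℤ) (hk : 0 < k) (x z : V)
    (hF : ∀ v, dvg F v = k * dEdge (x, z) v) :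
    Relation.ReflTransGen (fun a b => (a, b) ∈ F) x z := by
  by_contra hcon
  let S : Finset V := Finset.univ.filter (fun v => Relation.ReflTransGen (fun a b => (a, b) ∈ F) x v)
  have h1 := sum_dEdge k x z S (by simp [S, Relation.ReflTransGen.refl]) (by simpa [S] using hcon)
  rw [← Finset.sum_congr rfl (fun v _ => hF v), sum_dvg] at h1
  have : ∑ e ∈ F, ((if e.1 ∈ S then 1 else 0) - (if e.2 ∈ S then 1 else 0) : ℤ) ≤ 0 := by
    refine Finset.sum_nonpos fun e he => ?_
    have : e.1 ∈ S → e.2 ∈ S := by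
      intro h
      simp only [S, Finset.mem_filter, Finset.mem_univ, true_and] at h ⊢
      exact h.tail he
    by_cases h : e.1 ∈ S
    · simp [h, this h]
    · simp only [h, if_false]; split_ifs <;> simp
  omega

open Classical in
theorem two_of_flow {V : Type*} [Fintype V] (E : V → V → Prop) (F : Finset (V × V)) (x z : V)
    (hFE : ∀ e ∈ F, E e.1 e.2)
    (hF : ∀ v, dvg F v = 2 * dEdge (x, z) v) : TwoEDP E x z := by
  obtain ⟨p, hp⟩ := exists_dipath _ _ _ (reach_of_flow F 2 (by norm_num) x z hF)
  have hpe := (chain_iff_edges _ _).1 hp.1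
  have hsub : (dipathEdges p).toFinset ⊆ F := fun e he => hpe e (List.mem_toFinset.1 he)
  have hd := dvg_path z p x hp.2.2.2 hp.2.1 hp.2.2.1
  have hF' : ∀ v, dvg (F \ (dipathEdges p).toFinset) v = 1 * dEdge (x, z) v := by
    intro v
    have h := Finset.sum_sdiff (f := fun e => dEdge e v) hsub
    have h1 := hd v
    have h2 := hF v
    unfold dvg at *
    linarith
  obtain ⟨q, hq⟩ := exists_dipath _ _ _ (reach_of_flow _ 1 (by norm_num) x z hF')
  have hqe := (chain_iff_edges _ _).1 hq.1
  refine ⟨p, q, ⟨(chain_iff_edges _ _).2 fun e he => hFE e (hpe e he), hp.2⟩,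
    ⟨(chain_iff_edges _ _).2 fun e he => hFE e (Finset.mem_sdiff.1 (hqe e he)).1, hq.2⟩, ?_⟩
  intro e he he'
  exact (Finset.mem_sdiff.1 (hqe e he')).2 (List.mem_toFinset.2 he)

theorem dEdge_swap {V : Type*} (e : V × V) (v : V) : dEdge e.swap v = - dEdge e v := by
  simp [dEdge]

open Classical in
theorem dvg_augment {V : Type*} (F P : Finset (V × V)) (hdis : ∀ e ∈ P, e ∈ F → e.swap ∈ F) (v : V) :
    dvg (F.filter (fun e => e.swap ∉ P) ∪ P.filter (fun e => e.swap ∉ F)) v = dvg F v + dvg P v := by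
  have hd : Disjoint (F.filter (fun e => e.swap ∉ P)) (P.filter (fun e => e.swap ∉ F)) := by
    rw [Finset.disjoint_left]
    intro e h1 h2
    simp only [Finset.mem_filter] at h1 h2
    exact h2.2 (hdis e h2.1 h1.1)
  have hs : ∑ e ∈ F.filter (fun e => e.swap ∈ P), dEdge e v
      = - ∑ e ∈ P.filter (fun e => e.swap ∈ F), dEdge e v := by
    rw [← Finset.sum_neg_distrib]
    refine Finset.sum_bij' (fun e _ => e.swap) (fun e _ => e.swap) ?_ ?_ ?_ ?_ ?_
    · intro e; simp; tauto
    · intro e; simp; tauto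
    · simp
    · simp
    · intro e _; rw [dEdge_swap]; simp
  have h1 := Finset.sum_filter_add_sum_filter_not F (fun e => e.swap ∈ P) (fun e => dEdge e v)
  have h2 := Finset.sum_filter_add_sum_filter_not P (fun e => e.swap ∈ F) (fun e => dEdge e v)
  unfold dvg
  rw [Finset.sum_union hd]
  linarith

open Classical in
theorem menger_two {V : Type*} [Fintype V] (E : V → V → Prop) (x z : V)
    (h0 : Relation.ReflTransGen E x z)
    (h : ∀ e : V × V, Relation.ReflTransGen (fun a b => E a b ∧ (a, b) ≠ e) x z) :
    TwoEDP E x z := by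
  obtain ⟨p, hp⟩ := exists_dipath _ _ _ h0
  have hpe := (chain_iff_edges _ _).1 hp.1
  have hd := dvg_path z p x hp.2.2.2 hp.2.1 hp.2.2.1
  set F := (dipathEdges p).toFinset with hFdef
  have hFE : ∀ e ∈ F, E e.1 e.2 := fun e he => hpe e (List.mem_toFinset.1 he)
  let R : V → V → Prop := fun a b => (E a b ∧ (a, b) ∉ F) ∨ (b, a) ∈ F
  by_cases hR : Relation.ReflTransGen R x z
  · obtain ⟨q, hq⟩ := exists_dipath _ _ _ hR
    have hqe := (chain_iff_edges _ _).1 hq.1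
    have hdq := dvg_path z q x hq.2.2.2 hq.2.1 hq.2.2.1
    set P := (dipathEdges q).toFinset with hPdef
    have hPR : ∀ e ∈ P, R e.1 e.2 := fun e he => hqe e (List.mem_toFinset.1 he)
    refine two_of_flow E (F.filter (fun e => e.swap ∉ P) ∪ P.filter (fun e => e.swap ∉ F)) x z ?_ ?_
    · intro e he
      rw [Finset.mem_union, Finset.mem_filter, Finset.mem_filter] at he
      rcases he with he | he
      · exact hFE e he.1
      · rcases hPR e he.1 with h | h
        · exact h.1
        · exact absurd h he.2
    · intro v
      rw [dvg_augment, hd, hdq]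
      · ring
      · intro e he heF
        rcases hPR e he with h | h
        · exact absurd heF h.2
        · exact h
  · exfalso
    let S : Finset V := Finset.univ.filter (fun v => Relation.ReflTransGen R x v)
    have hxS : x ∈ S := by simp [S, Relation.ReflTransGen.refl]
    have hzS : z ∉ S := by simpa [S] using hR
    have hcl : ∀ a b, a ∈ S → R a b → b ∈ S := by
      intro a b ha hab
      simp only [S, Finset.mem_filter, Finset.mem_univ, true_and] at ha ⊢
      exact ha.tail hab
    have h1 := sum_dEdge 1 x z S hxS hzS
    simp only [one_mul] at h1
    rw [← Finset.sum_congr rfl (fun v _ => hd v), sum_dvg] at h1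
    have h2 : ∑ e ∈ F, ((if e.1 ∈ S then 1 else 0) - (if e.2 ∈ S then 1 else 0) : ℤ)
        = ∑ e ∈ F, (if e.1 ∈ S ∧ e.2 ∉ S then 1 else 0 : ℤ) := by
      refine Finset.sum_congr rfl fun e he => ?_
      have : e.2 ∈ S → e.1 ∈ S := fun h => hcl _ _ h (Or.inr he)
      by_cases h1 : e.1 ∈ S <;> by_cases h2 : e.2 ∈ S <;> simp_all
    rw [h2, Finset.sum_boole] at h1
    have h3 : (F.filter (fun e => e.1 ∈ S ∧ e.2 ∉ S)).card = 1 := by exact_mod_cast h1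
    obtain ⟨e, he⟩ := Finset.card_eq_one.1 h3
    apply hzS
    have key : ∀ v, Relation.ReflTransGen (fun a b => E a b ∧ (a, b) ≠ e) x v → v ∈ S := by
      intro v hv
      induction hv with
      | refl => exact hxS
      | tail hxb hbc ih =>
        rename_i b c
        by_contra hc
        by_cases hF : (b, c) ∈ F
        · have : (b, c) ∈ F.filter (fun e => e.1 ∈ S ∧ e.2 ∉ S) := by
            simp [hF, ih, hc]
          rw [he, Finset.mem_singleton] at this
          exact hbc.2 this
        · exact hc (hcl _ _ ih (Or.inl ⟨hbc.1, hF⟩))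
    exact key z (h e)

theorem TwoEDP.reach_avoid {V : Type*} {E : V → V → Prop} {x y : V} (h : TwoEDP E x y) (e : V × V) :
    Relation.ReflTransGen (fun a b => E a b ∧ (a, b) ≠ e) x y := by
  obtain ⟨p, q, hp, hq, hd⟩ := h
  have aux : ∀ r, IsDipath E x y r → e ∉ dipathEdges r →
      Relation.ReflTransGen (fun a b => E a b ∧ (a, b) ≠ e) x y := by
    intro r hr her
    refine reach_of_dipath _ y r x ((chain_iff_edges _ _).2 fun f hf => ?_) hr.2.1 hr.2.2.1
    refine ⟨(chain_iff_edges _ _).1 hr.1 f hf, ?_⟩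
    rintro rfl
    exact her hf
  by_cases hep : e ∈ dipathEdges p
  · exact aux q hq (hd e hep)
  · exact aux p hp hep

theorem TwoEDP.trans' {V : Type*} [Fintype V] {E : V → V → Prop} {x y z : V}
    (h₁ : TwoEDP E x y) (h₂ : TwoEDP E y z) : TwoEDP E x z := by
  have h := fun e => (h₁.reach_avoid e).trans (h₂.reach_avoid e)
  exact menger_two E x z (Relation.ReflTransGen.mono
    (r := fun a b => E a b ∧ (a, b) ≠ (x, x)) (p := E) (fun _ _ h => h.1) _ _ (h (x, x))) h

/-- Lemma 15: the 2-edge blocks of a strongly connected finite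
simple digraph are pairwise disjoint. -/
theorem stmt11 {V : Type*} [Fintype V] (E : V → V → Prop)
    (hirr : ∀ v, ¬ E v v) (hsc : IsStronglyConn E) (C₁ C₂ : Set V)
    (h₁ : IsMaxBlock (Rel2e E) 2 C₁) (h₂ : IsMaxBlock (Rel2e E) 2 C₂)
    (hne : C₁ ≠ C₂) : C₁ ∩ C₂ = ∅ := by
  by_contra hcon
  obtain ⟨w, hw1, hw2⟩ := Set.nonempty_iff_ne_empty.2 hcon
  apply hne
  have hsymm : ∀ {a b}, Rel2e E a b → Rel2e E b a := fun h => ⟨h.1.symm, h.2.2, h.2.1⟩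
  have hmix : ∀ a ∈ C₁, ∀ b ∈ C₂, a ≠ b → Rel2e E a b := by
    intro a ha b hb hab
    by_cases haw : a = w
    · exact h₂.2.1 a (haw ▸ hw2) b hb hab
    by_cases hbw : b = w
    · exact h₁.2.1 a ha b (hbw ▸ hw1) hab
    have r1 := h₁.2.1 a ha w hw1 haw
    have r2 := h₂.2.1 w hw2 b hb (Ne.symm hbw)
    exact ⟨hab, r1.2.1.trans' r2.2.1, r2.2.2.trans' r1.2.2⟩
  have hD : ∀ x ∈ C₁ ∪ C₂, ∀ y ∈ C₁ ∪ C₂, x ≠ y → Rel2e E x y := by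
    rintro x (hx | hx) y (hy | hy) hxy
    · exact h₁.2.1 x hx y hy hxy
    · exact hmix x hx y hy hxy
    · exact hsymm (hmix y hy x hx hxy.symm)
    · exact h₂.2.1 x hx y hy hxy
  rw [← h₁.2.2 _ Set.subset_union_left hD]
  exact h₂.2.2 _ Set.subset_union_right hD
end

section
/- Let G = (V,E) be a strongly connected finite simple directed graph, let v ∈ V, and let w be any vertex distinct from v. Then x ↔^{2e} holds between v and w (i.e., there exist two edge-disjoint paths from v to w and two edge-disjoint paths from w to v in G) if and only if w has no edge dominator in the flowgraph G(v) = (V,E,v) and w has no edge dominator in the flowgraph G^R(v) = (V, E^R, v) on the reversal graph of G. -/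
variable {V : Type*}

/-- The edge `e` is an edge dominator of `w` in the flowgraph with edge relation `E`
and start `s`: `e` is an edge of the graph and every path from `s` to `w` contains
`e`. -/
def EdgeDominator {α : Type*} (E : α → α → Prop) (s : α) (e : α × α) (w : α) : Prop :=
  E e.1 e.2 ∧ ∀ p : List α, IsDipath E s w p → e ∈ dipathEdges p

section helpers
open Classical

theorem aux_edges_cons {V : Type*} (x y : V) (l : List V) :
    dipathEdges (x :: y :: l) = (x, y) :: dipathEdges (y :: l) := rfl

theorem aux_mem_left {V : Type*} (p : List V) (a b : V) (h : (a, b) ∈ dipathEdges p) : a ∈ p :=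
  (List.of_mem_zip h).1

theorem aux_mem_right {V : Type*} (p : List V) (a b : V) (h : (a, b) ∈ dipathEdges p) : b ∈ p :=
  List.mem_of_mem_tail (List.of_mem_zip h).2

theorem aux_edge_rel {V : Type*} (E : V → V → Prop) (p : List V) (hp : List.IsChain E p) :
    ∀ a b, (a, b) ∈ dipathEdges p → E a b := by
  induction p with
  | nil => intro a b h; simp [dipathEdges] at h
  | cons x l ih =>
    cases l with
    | nil => intro a b h; simp [dipathEdges] at h
    | cons y l =>
      intro a b h
      rw [List.isChain_cons_cons] at hp
      rw [aux_edges_cons, List.mem_cons] at h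
      rcases h with h | h
      · cases h; exact hp.1
      · exact ih hp.2 a b h

theorem aux_path {V : Type*} (E : V → V → Prop) (x y : V) (h : Relation.ReflTransGen E x y) :
    ∃ p, IsDipath E x y p := by
  induction h using Relation.ReflTransGen.head_induction_on with
  | refl => exact ⟨[y], List.isChain_singleton _, rfl, rfl, by simp⟩
  | @head a c hac _ ih =>
    obtain ⟨p, h1, h2, h3, h4⟩ := ih
    by_cases hm : a ∈ p
    · obtain ⟨l1, l2, rfl⟩ := List.append_of_mem hm
      refine ⟨a :: l2, (List.isChain_append.1 h1).2.1, rfl, ?_, (List.nodup_append.1 h4).2.1⟩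
      rw [List.getLast?_append] at h3
      simpa [List.getLast?_cons] using h3
    · cases p with
      | nil => simp at h2
      | cons z l =>
        simp at h2
        subst h2
        exact ⟨a :: z :: l, List.isChain_cons_cons.2 ⟨hac, h1⟩, rfl, by
          simpa [List.getLast?_cons] using h3, List.nodup_cons.2 ⟨hm, h4⟩⟩

theorem aux_cross {V : Type*} (S : V → Prop) (y : V) (hy : ¬ S y) (p : List V) :
    ∀ x, p.head? = some x → p.getLast? = some y → S x →
      ∃ a b, (a, b) ∈ dipathEdges p ∧ S a ∧ ¬ S b := by
  induction p with
  | nil => intro x h; simp at h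
  | cons z l ih =>
    intro x h1 h2 hx
    simp at h1
    subst h1
    cases l with
    | nil => simp at h2; subst h2; exact absurd hx hy
    | cons c l =>
      by_cases hc : S c
      · obtain ⟨a, b, h, hab⟩ := ih c rfl (by simpa [List.getLast?_cons] using h2) hc
        exact ⟨a, b, List.mem_cons_of_mem _ h, hab⟩
      · exact ⟨z, c, List.mem_cons_self, hx, hc⟩

/-- indicator of the edges of a path -/
noncomputable def auxInd {V : Type*} (p : List V) (a b : V) : ℤ :=
  if (a, b) ∈ dipathEdges p then 1 else 0

noncomputable def auxNet {V : Type*} [Fintype V] (f : V → V → ℤ) (u : V) : ℤ :=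
  ∑ b, (f u b - f b u)

theorem aux_net_ind {V : Type*} [Fintype V] (y : V) (p : List V) :
    ∀ x, p.head? = some x → p.getLast? = some y → p.Nodup → ∀ u,
      auxNet (auxInd p) u = (if u = x then 1 else 0) - (if u = y then 1 else 0) := by
  induction p with
  | nil => intro x h; simp at h
  | cons z l ih =>
    intro x h1 h2 hn u
    simp at h1
    subst h1
    cases l with
    | nil => simp at h2; subst h2; simp [auxNet, auxInd, dipathEdges]
    | cons c l =>
      have hn' := List.nodup_cons.1 hn
      have := ih c rfl (by simpa [List.getLast?_cons] using h2) hn'.2 u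
      have key : ∀ a b, auxInd (z :: c :: l) a b =
          (if a = z then 1 else 0) * (if b = c then 1 else 0) + auxInd (c :: l) a b := by
        intro a b
        unfold auxInd
        simp only [aux_edges_cons, List.mem_cons]
        by_cases hz : a = z
        · have : (a, b) ∉ dipathEdges (c :: l) := fun h => hn'.1 (hz ▸ aux_mem_left _ _ _ h)
          subst hz
          simp [this]
        · simp [hz]
      have e : auxNet (auxInd (z :: c :: l)) u =
          ((if u = z then 1 else 0) - (if u = c then 1 else 0)) + auxNet (auxInd (c :: l)) u := by
        unfold auxNet
        simp only [key]
        have : ∀ b, ((if u = z then (1:ℤ) else 0) * (if b = c then 1 else 0) + auxInd (c :: l) u b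
          - ((if b = z then 1 else 0) * (if u = c then 1 else 0) + auxInd (c :: l) b u))
          = (if u = z then (1:ℤ) else 0) * (if b = c then 1 else 0)
            - (if b = z then 1 else 0) * (if u = c then 1 else 0)
            + (auxInd (c :: l) u b - auxInd (c :: l) b u) := by intro b; ring
        simp only [this]
        rw [Finset.sum_add_distrib, Finset.sum_sub_distrib, ← Finset.mul_sum, ← Finset.sum_mul]
        simp
      rw [e, this]; ring

theorem aux_cut {V : Type*} [Fintype V] (f : V → V → ℤ) (S : Finset V) :
    ∑ u ∈ S, auxNet f u = ∑ u ∈ S, ∑ b ∈ Sᶜ, (f u b - f b u) := by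
  have h : ∑ u ∈ S, ∑ b ∈ S, (f u b - f b u) = 0 := by
    simp only [Finset.sum_sub_distrib]
    rw [Finset.sum_comm (f := fun u b => f b u)]
    simp
  unfold auxNet
  have : ∀ u, ∑ b, (f u b - f b u) = ∑ b ∈ S, (f u b - f b u) + ∑ b ∈ Sᶜ, (f u b - f b u) :=
    fun u => (Finset.sum_add_sum_compl S _).symm
  simp only [this]
  rw [Finset.sum_add_distrib, h, zero_add]

def AuxFlow {V : Type*} [Fintype V] (s t : V) (k : ℤ) (f : V → V → ℤ) : Prop :=
  ∀ u, auxNet f u = k * ((if u = s then 1 else 0) - (if u = t then 1 else 0))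

theorem aux_flow_cut {V : Type*} [Fintype V] (s t : V) (k : ℤ) (f : V → V → ℤ)
    (hf : AuxFlow s t k f) (S : Finset V) (hs : s ∈ S) (ht : t ∉ S) :
    ∑ u ∈ S, ∑ b ∈ Sᶜ, (f u b - f b u) = k := by
  rw [← aux_cut, Finset.sum_congr rfl (fun u _ => hf u), ← Finset.mul_sum,
    Finset.sum_sub_distrib]
  simp [hs, ht]

theorem aux_extract {V : Type*} [Fintype V] (s t : V) (k : ℤ) (hk : 0 < k) (f : V → V → ℤ)
    (h0 : ∀ a b, 0 ≤ f a b) (hf : AuxFlow s t k f) :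
    ∃ p, IsDipath (fun a b => 0 < f a b) s t p := by
  apply aux_path
  by_contra hc
  let S : Finset V := Finset.univ.filter (Relation.ReflTransGen (fun a b => 0 < f a b) s)
  have h := aux_flow_cut s t k f hf S (by simp [S, Relation.ReflTransGen.refl]) (by simpa [S] using hc)
  have : ∑ u ∈ S, ∑ b ∈ Sᶜ, (f u b - f b u) ≤ 0 := by
    apply Finset.sum_nonpos
    intro u hu
    apply Finset.sum_nonpos
    intro b hb
    have h1 : ¬ 0 < f u b := by
      intro hlt
      simp [S] at hu hb
      exact hb (hu.tail hlt)
    have := h0 b u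
    omega
  omega

theorem aux_sub {V : Type*} [Fintype V] (s t : V) (k : ℤ) (f : V → V → ℤ)
    (hf : AuxFlow s t k f) (p : List V) (E : V → V → Prop) (hp : IsDipath E s t p) :
    AuxFlow s t (k - 1) (fun a b => f a b - auxInd p a b) := by
  intro u
  have h1 := aux_net_ind t p s hp.2.1 hp.2.2.1 hp.2.2.2 u
  have h2 := hf u
  have : auxNet (fun a b => f a b - auxInd p a b) u = auxNet f u - auxNet (auxInd p) u := by
    unfold auxNet
    rw [← Finset.sum_sub_distrib]
    exact Finset.sum_congr rfl fun _ _ => by ring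
  rw [this, h1, h2]; ring

theorem aux_mono {V : Type*} {E F : V → V → Prop} {x y : V} {p : List V}
    (h : ∀ a b, E a b → F a b) (hp : IsDipath E x y p) : IsDipath F x y p :=
  ⟨List.IsChain.imp h hp.1, hp.2⟩

theorem aux_decomp {V : Type*} [Fintype V] (E : V → V → Prop) (s t : V) (f : V → V → ℤ)
    (h0 : ∀ a b, 0 ≤ f a b) (h1 : ∀ a b, f a b ≤ if E a b then 1 else 0)
    (hf : AuxFlow s t 2 f) : TwoEDP E s t := by
  have hE : ∀ a b, 0 < f a b → E a b := by
    intro a b h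
    by_contra hc
    have := h1 a b
    simp [hc] at this
    omega
  obtain ⟨p, hp⟩ := aux_extract s t 2 (by norm_num) f h0 hf
  have hle : ∀ a b, 0 ≤ f a b - auxInd p a b := by
    intro a b
    unfold auxInd
    split_ifs with h
    · have := aux_edge_rel _ p hp.1 a b h
      omega
    · simpa using h0 a b
  obtain ⟨q, hq⟩ := aux_extract s t (2 - 1) (by norm_num) _ hle (aux_sub s t 2 f hf p _ hp)
  have hi : ∀ a b, 0 ≤ auxInd p a b := by
    intro a b; unfold auxInd; split_ifs <;> simp
  refine ⟨p, q, aux_mono hE hp, aux_mono (fun a b h => hE a b ?_) hq, ?_⟩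
  · have := hi a b
    omega
  · rintro ⟨a, b⟩ hep heq
    have h2 := aux_edge_rel _ q hq.1 a b heq
    have h3 := h1 a b
    simp only [auxInd, hep, if_true] at h2
    split_ifs at h3 <;> omega

theorem aux_augment {V : Type*} [Fintype V] (E : V → V → Prop) (s t : V)
    (H : ∀ e : V × V, ∃ p, IsDipath E s t p ∧ e ∉ dipathEdges p)
    (k : ℤ) (hk : k < 2) (f : V → V → ℤ)
    (h0 : ∀ a b, 0 ≤ f a b) (h1 : ∀ a b, f a b ≤ if E a b then 1 else 0)
    (hf : AuxFlow s t k f) :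
    ∃ g : V → V → ℤ, (∀ a b, 0 ≤ g a b) ∧ (∀ a b, g a b ≤ if E a b then 1 else 0) ∧
      AuxFlow s t (k + 1) g := by
  let c : V → V → ℤ := fun a b => if E a b then 1 else 0
  have h1 : ∀ a b, f a b ≤ c a b := h1
  let R : V → V → Prop := fun a b => f a b < c a b ∨ 0 < f b a
  by_cases hr : Relation.ReflTransGen R s t
  · obtain ⟨p, hp⟩ := aux_path R s t hr
    refine ⟨fun a b => f a b + (if (a, b) ∈ dipathEdges p ∧ f a b < c a b then 1 else 0)
      - (if (b, a) ∈ dipathEdges p ∧ ¬ f b a < c b a then 1 else 0), ?_, ?_, ?_⟩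
    · intro a b
      have := h0 a b
      have h2 : ((b, a) ∈ dipathEdges p ∧ ¬ f b a < c b a) → 0 < f a b := by
        rintro ⟨h, h'⟩
        exact (aux_edge_rel R p hp.1 b a h).resolve_left h'
      dsimp only
      split_ifs with h3 h4 h4 <;> first | omega | (have := h2 h4; omega)
    · intro a b
      have := h1 a b
      change _ ≤ c a b
      dsimp only
      split_ifs with h3 h4 h4 <;> first | omega | (have := h3.2; omega)
    · intro u
      have e1 := aux_net_ind t p s hp.2.1 hp.2.2.1 hp.2.2.2 u
      have e2 := hf u
      have : auxNet (fun a b => f a b + (if (a, b) ∈ dipathEdges p ∧ f a b < c a b then 1 else 0)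
          - (if (b, a) ∈ dipathEdges p ∧ ¬ f b a < c b a then 1 else 0)) u
          = auxNet f u + auxNet (auxInd p) u := by
        unfold auxNet
        rw [← Finset.sum_add_distrib]
        refine Finset.sum_congr rfl fun b _ => ?_
        unfold auxInd
        by_cases g1 : (u, b) ∈ dipathEdges p <;> by_cases g2 : (b, u) ∈ dipathEdges p <;>
          by_cases g3 : f u b < c u b <;> by_cases g4 : f b u < c b u <;>
          simp only [g1, g2, g3, g4, and_true, and_false, not_true, not_false_iff, true_and,
            false_and, if_true, if_false] <;> ring
      rw [this, e1, e2]; ring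
  · exfalso
    let S : Finset V := Finset.univ.filter (Relation.ReflTransGen R s)
    have hs : s ∈ S := by simp [S, Relation.ReflTransGen.refl]
    have ht : t ∉ S := by simpa [S] using hr
    have h := aux_flow_cut s t k f hf S hs ht
    have e : ∑ u ∈ S, ∑ b ∈ Sᶜ, (f u b - f b u) = ∑ x ∈ S ×ˢ Sᶜ, c x.1 x.2 := by
      rw [Finset.sum_product]
      refine Finset.sum_congr rfl fun u hu => Finset.sum_congr rfl fun b hb => ?_
      have hR : ¬ R u b := by
        intro hlt
        simp [S] at hu hb
        exact hb (hu.tail hlt)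
      simp only [R, not_or] at hR
      have := h0 b u
      have := h1 u b
      dsimp only
      omega
    obtain ⟨p, hp, -⟩ := H (s, s)
    obtain ⟨a, b, hab, ha, hb⟩ := aux_cross (· ∈ S) t ht p s hp.2.1 hp.2.2.1 hs
    obtain ⟨q, hq, hne⟩ := H (a, b)
    obtain ⟨a', b', hab', ha', hb'⟩ := aux_cross (· ∈ S) t ht q s hq.2.1 hq.2.2.1 hs
    have hd : (a, b) ≠ (a', b') := by
      intro h; rw [h] at hne; exact hne hab'
    have hsub : ({(a, b), (a', b')} : Finset (V × V)) ⊆ S ×ˢ Sᶜ := by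
      intro x hx
      simp only [Finset.mem_insert, Finset.mem_singleton] at hx
      rcases hx with rfl | rfl
      · exact Finset.mem_product.2 ⟨ha, Finset.mem_compl.2 hb⟩
      · exact Finset.mem_product.2 ⟨ha', Finset.mem_compl.2 hb'⟩
    have hle := Finset.sum_le_sum_of_subset_of_nonneg (f := fun x : V × V => c x.1 x.2) hsub
      (fun x _ _ => by dsimp only [c]; split_ifs <;> simp)
    rw [Finset.sum_pair hd] at hle
    have c1 : c a b = 1 := if_pos (aux_edge_rel E p hp.1 a b hab)
    have c2 : c a' b' = 1 := if_pos (aux_edge_rel E q hq.1 a' b' hab')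
    dsimp only at hle
    rw [c1, c2, ← e, h] at hle
    omega

theorem aux_menger {V : Type*} [Fintype V] (E : V → V → Prop) (s t : V)
    (H : ∀ e : V × V, ∃ p, IsDipath E s t p ∧ e ∉ dipathEdges p) : TwoEDP E s t := by
  obtain ⟨f, f0, f1, hf⟩ := aux_augment E s t H 0 (by norm_num) (fun _ _ => 0) (by simp)
    (by intro a b; split_ifs <;> simp) (by intro u; simp [auxNet])
  obtain ⟨g, g0, g1, hg⟩ := aux_augment E s t H _ (by norm_num) f f0 f1 hf
  exact aux_decomp E s t g g0 g1 (by simpa using hg)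

theorem aux_iff {V : Type*} [Fintype V] (E : V → V → Prop) (s t : V)
    (hr : Relation.ReflTransGen E s t) :
    TwoEDP E s t ↔ ¬ ∃ e : V × V, EdgeDominator E s e t := by
  constructor
  · rintro ⟨p, q, hp, hq, h⟩ ⟨e, -, he⟩
    exact h e (he p hp) (he q hq)
  · intro h
    apply aux_menger
    intro e
    by_contra hc
    push Not at hc
    obtain ⟨p, hp⟩ := aux_path E s t hr
    exact h ⟨e, aux_edge_rel E p hp.1 e.1 e.2 (hc p hp), hc⟩

theorem aux_edges_append {V : Type*} (l : List V) (y x : V) :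
    ∀ e, e ∈ dipathEdges (l ++ [y, x]) → e ∈ dipathEdges (l ++ [y]) ∨ e = (y, x) := by
  induction l with
  | nil => intro e h; simpa [dipathEdges] using h
  | cons z l ih =>
    intro e h
    cases l with
    | nil => simpa [dipathEdges] using h
    | cons c l =>
      simp only [List.cons_append, aux_edges_cons, List.mem_cons] at h ih ⊢
      rcases h with h | h
      · exact Or.inl (Or.inl h)
      · rcases ih e h with h | h
        · exact Or.inl (Or.inr h)
        · exact Or.inr h

theorem aux_edges_rev {V : Type*} (p : List V) :
    ∀ a b, (a, b) ∈ dipathEdges p.reverse → (b, a) ∈ dipathEdges p := by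
  induction p with
  | nil => intro a b h; simp [dipathEdges] at h
  | cons x l ih =>
    cases l with
    | nil => intro a b h; simp [dipathEdges] at h
    | cons y l =>
      intro a b h
      have e : (x :: y :: l).reverse = l.reverse ++ [y, x] := by simp
      rw [e] at h
      rw [aux_edges_cons, List.mem_cons]
      rcases aux_edges_append _ _ _ _ h with h | h
      · right; apply ih; simpa using h
      · left; cases h; rfl

theorem aux_path_rev {V : Type*} (E : V → V → Prop) (x y : V) (p : List V)
    (h : IsDipath E x y p) : IsDipath (fun a b => E b a) y x p.reverse :=
  ⟨List.isChain_reverse.2 h.1, by simpa using h.2.2.1, by simpa using h.2.1,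
    List.nodup_reverse.2 h.2.2.2⟩

theorem aux_rev {V : Type*} (E : V → V → Prop) (x y : V) (h : TwoEDP E x y) :
    TwoEDP (fun a b => E b a) y x := by
  obtain ⟨p, q, hp, hq, h⟩ := h
  exact ⟨p.reverse, q.reverse, aux_path_rev E x y p hp, aux_path_rev E x y q hq,
    fun e h1 h2 => h (e.2, e.1) (aux_edges_rev p _ _ h1) (aux_edges_rev q _ _ h2)⟩

end helpers

/-- Lemma 18: `v ↔^{2e} w` iff `w` has no edge dominator in the
flowgraph `G(v)` and no edge dominator in the flowgraph `G^R(v)` on the reversal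
graph. -/
theorem stmt12 {V : Type*} [Fintype V] (E : V → V → Prop)
    (hirr : ∀ u, ¬ E u u) (hsc : IsStronglyConn E) (v w : V) (hvw : w ≠ v) :
    (TwoEDP E v w ∧ TwoEDP E w v) ↔
      ((¬ ∃ e : V × V, EdgeDominator E v e w) ∧
        ¬ ∃ e : V × V, EdgeDominator (fun a b => E b a) v e w) := by
  rw [← aux_iff E v w (hsc v w), ← aux_iff (fun a b => E b a) v w
    (Relation.reflTransGen_swap.2 (hsc w v))]
  exact and_congr_right fun _ => ⟨aux_rev E w v, aux_rev (fun a b => E b a) v w⟩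
end

section
/- Let G = (V,E) be a strongly connected finite simple directed graph, let v and w be distinct vertices with v ↔² w, and let C be the 2-directed block of G containing both v and w. For a vertex u, let N(u) denote the set of vertices z ∈ V \ {u} with u ↔² z. Then C = (N(v) ∩ N(w)) ∪ {v, w}. -/
variable {V : Type*}

namespace Aux14

/-- `s :: (m ++ [b])` is a simple path from `s` hitting `T` only at its end `b`
(nothing is required of `s`). -/
structure Good (E : V → V → Prop) (s : V) (T : Set V) (m : List V) (b : V) : Prop where
  chain : List.IsChain E (s :: (m ++ [b]))
  mem : b ∈ T
  nmem : ∀ u ∈ m, u ∉ T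
  nodup : (s :: (m ++ [b])).Nodup

theorem chain_suffix {E : V → V → Prop} {s x b : V} {l r : List V}
    (h : List.IsChain E (s :: ((l ++ x :: r) ++ [b]))) : List.IsChain E (x :: (r ++ [b])) := by
  have : (s :: ((l ++ x :: r) ++ [b])) = (s :: l) ++ (x :: (r ++ [b])) := by simp
  rw [this] at h
  exact (List.isChain_append.1 h).2.1

theorem chain_prefix {E : V → V → Prop} {s x b : V} {l r : List V}
    (h : List.IsChain E (s :: ((l ++ x :: r) ++ [b]))) : List.IsChain E (s :: (l ++ [x])) := by
  have : (s :: ((l ++ x :: r) ++ [b])) = (s :: (l ++ [x])) ++ (r ++ [b]) := by simp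
  rw [this] at h
  exact (List.isChain_append.1 h).1

theorem chain_glue {E : V → V → Prop} {s x b : V} {l r : List V}
    (h : List.IsChain E (s :: (l ++ [x]))) (h' : List.IsChain E (x :: (r ++ [b]))) :
    List.IsChain E (s :: ((l ++ x :: r) ++ [b])) := by
  induction l generalizing s with
  | nil => simp_all
  | cons y l ih => 
    simp only [List.cons_append, List.isChain_cons_cons] at h ⊢
    exact ⟨h.1, by simpa using ih h.2⟩

theorem trunc {F : V → V → Prop} {T : Set V} {s y : V} (h : Relation.ReflTransGen F s y)
    (hy : y ∈ T) (hs : s ∉ T) : ∃ m c, Good F s T m c := by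
  classical
  induction h using Relation.ReflTransGen.head_induction_on with
  | refl => exact absurd hy hs
  | @head s s' e _ ih =>
    by_cases hs' : s' ∈ T
    · exact ⟨[], s', by simpa using e, hs', by simp, by
        have : s ≠ s' := fun h => hs (h ▸ hs')
        simpa using this⟩
    · obtain ⟨m, c, g⟩ := ih hs'
      have hsc : s ≠ c := fun h => hs (h ▸ g.mem)
      have gn := g.nodup
      have gm := g.nmem
      by_cases h1 : s = s'
      · subst h1; exact ⟨m, c, g⟩
      by_cases h2 : s ∈ m
      · obtain ⟨l, r, rfl⟩ := List.append_of_mem h2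
        refine ⟨r, c, chain_suffix g.chain, g.mem, fun u hu => gm u (by simp [hu]), ?_⟩
        have : (s' :: ((l ++ s :: r) ++ [c])) = (s' :: l) ++ (s :: (r ++ [c])) := by simp
        rw [this] at gn
        exact (List.nodup_append.1 gn).2.1
      · refine ⟨s' :: m, c, ?_, g.mem, ?_, ?_⟩
        · simpa using ⟨e, g.chain⟩
        · intro u hu
          rcases List.mem_cons.1 hu with rfl | hu
          · exact hs'
          · exact gm u hu
        · rw [List.cons_append, List.nodup_cons]
          exact ⟨by simp [h1, h2, hsc], gn⟩

theorem chain_avoid {E : V → V → Prop} {z s : V} {l : List V}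
    (h : List.IsChain (DelVertex E z) (s :: l)) : z ∉ l := by
  induction l generalizing s with
  | nil => simp
  | cons y l ih =>
    rw [List.isChain_cons_cons] at h
    have := ih h.2
    simp [this, h.1.2.2.symm]

theorem trunc_del {E : V → V → Prop} {T : Set V} {s y z : V}
    (h : Relation.ReflTransGen (DelVertex E z) s y)
    (hy : y ∈ T) (hs : s ∉ T) : ∃ m c, Good E s T m c ∧ z ∉ m ∧ z ≠ c := by
  obtain ⟨m, c, g⟩ := trunc h hy hs
  have := chain_avoid g.chain
  simp only [List.mem_append, List.mem_singleton, not_or] at this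
  exact ⟨m, c, ⟨g.chain.imp fun _ _ h => h.1, g.mem, g.nmem, g.nodup⟩, this⟩

theorem exists_last_mem (m : List V) (r : List V) (h : ∃ x ∈ r, x ∈ m) :
    ∃ r1 x r2, r = r1 ++ x :: r2 ∧ x ∈ m ∧ ∀ u ∈ r2, u ∉ m := by
  induction r with
  | nil => simp at h
  | cons y r ih =>
    by_cases h' : ∃ x ∈ r, x ∈ m
    · obtain ⟨r1, x, r2, rfl, hx, h2⟩ := ih h'
      exact ⟨y :: r1, x, r2, by simp, hx, h2⟩
    · push Not at h'
      refine ⟨[], y, r, rfl, ?_, h'⟩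
      obtain ⟨x, hx, hxm⟩ := h
      rcases List.mem_cons.1 hx with rfl | hx
      · exact hxm
      · exact absurd hxm (h' x hx)

set_option maxHeartbeats 2000000 in
theorem fan {E : V → V → Prop} {s : V} (n : ℕ) : ∀ (T : Set V) (m : List V) (b : V),
    m.length ≤ n → s ∉ T →
    (∀ z, z ≠ s → ∃ y ∈ T, Relation.ReflTransGen (DelVertex E z) s y) →
    Good E s T m b →
    ∃ m1 m2 c, Good E s T m1 b ∧ Good E s T m2 c ∧ b ≠ c ∧ b ∉ m2 ∧ c ∉ m1 ∧
      ∀ u ∈ m1, u ∉ m2 := by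
  induction n with
  | zero =>
    intro T m b hn hs H g
    obtain rfl : m = [] := by simpa using hn
    have gn := g.nodup
    have hbs : b ≠ s := by rintro rfl; exact hs g.mem
    obtain ⟨y, hy, hr⟩ := H b hbs
    obtain ⟨r, c, gr, hbr, hbc⟩ := trunc_del hr hy hs
    exact ⟨[], r, c, g, gr, hbc, hbr, by simp, by simp⟩
  | succ n ih =>
    intro T m b hn hs H g
    have hbs : b ≠ s := by rintro rfl; exact hs g.mem
    obtain ⟨y, hy, hr⟩ := H b hbs
    obtain ⟨r, c, gr, hbr, hbc⟩ := trunc_del hr hy hs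
    by_cases hx : ∃ x ∈ r, x ∈ m
    swap
    · push Not at hx
      exact ⟨m, r, c, g, gr, hbc, hbr, fun h => g.nmem c h gr.mem, fun u hu hu' => hx u hu' hu⟩
    obtain ⟨r1, x, r2, rfl, hxm, hr2⟩ := exists_last_mem m r hx
    obtain ⟨a, d, rfl⟩ := List.append_of_mem hxm
    obtain ⟨gch, gT, gnT, gnd⟩ := g
    obtain ⟨rch, rT, rnT, rnd⟩ := gr
    have hmd := chain_suffix gch
    have hmr := chain_suffix rch
    have hdT : ∀ u ∈ d, u ∉ T := fun u hu => gnT u (by simp [hu])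
    have hxT : x ∉ T := gnT x (by simp)
    have hrT : ∀ u ∈ r2, u ∉ T := fun u hu => rnT u (by simp [hu])
    have hrd : ∀ u ∈ r2, u ∉ d ∧ u ≠ x ∧ u ∉ a := fun u hu => by
      have := hr2 u hu
      simp only [List.mem_append, List.mem_cons, not_or] at this
      exact ⟨this.2.2, this.2.1, this.1⟩
    simp only [List.nodup_cons, List.nodup_append, List.mem_append, List.mem_cons,
      List.mem_singleton] at gnd rnd hbr
    let T' : Set V := {u | u ∈ T ∨ u = x ∨ u ∈ d ∨ u ∈ r2}
    have hT' : ∀ u, u ∈ T' ↔ u ∈ T ∨ u = x ∨ u ∈ d ∨ u ∈ r2 := fun u => Iff.rfl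
    clear_value T'
    have hsT' : s ∉ T' := by grind
    obtain ⟨q1, q2, y, g1, g2, hxy, hxq2, hyq1, hq⟩ := ih T' a x (by simp at hn; omega) hsT'
      (fun z hz => by
        obtain ⟨y, hy, h⟩ := H z hz
        exact ⟨y, (hT' y).2 (Or.inl hy), h⟩)
      ⟨chain_prefix gch, (hT' x).2 (by simp), by grind, by
        simp only [List.nodup_cons, List.nodup_append, List.mem_append, List.mem_cons]
        grind⟩
    obtain ⟨c1, t1, n1, d1⟩ := g1
    obtain ⟨c2, t2, n2, d2⟩ := g2
    simp only [List.nodup_cons, List.nodup_append, List.mem_append, List.mem_cons,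
      List.mem_singleton] at d1 d2
    have e1 := fun u hu => mt (hT' u).2 (n1 u hu)
    have e2 := fun u hu => mt (hT' u).2 (n2 u hu)
    have f1 : ∀ u ∈ q1, u ∉ T := by grind
    have f2 : ∀ u ∈ q2, u ∉ T := by grind
    have Gd : Good E s T (q1 ++ x :: d) b := by
      refine ⟨chain_glue c1 hmd, gT, by grind, ?_⟩
      simp only [List.nodup_cons, List.nodup_append, List.mem_append, List.mem_cons]
      grind
    have Gr : Good E s T (q1 ++ x :: r2) c := by
      refine ⟨chain_glue c1 hmr, rT, by grind, ?_⟩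
      simp only [List.nodup_cons, List.nodup_append, List.mem_append, List.mem_cons]
      grind
    by_cases hyT : y ∈ T
    · have G2 : Good E s T q2 y := by
        refine ⟨c2, hyT, f2, ?_⟩
        simp only [List.nodup_cons, List.nodup_append, List.mem_append, List.mem_cons]
        grind
      by_cases hyb : y = b
      · subst hyb
        refine ⟨q2, q1 ++ x :: r2, c, G2, Gr, hbc, ?_, ?_, ?_⟩ <;> grind
      · refine ⟨q1 ++ x :: d, q2, y, Gd, G2, Ne.symm hyb, ?_, ?_, ?_⟩ <;> grind
    · have h3 : y ∈ d ∨ y ∈ r2 := by grind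
      rcases h3 with h3 | h3
      · obtain ⟨k1, k2, rfl⟩ := List.append_of_mem h3
        have G2 : Good E s T (q2 ++ y :: k2) b := by
          have hch := chain_glue c2 (chain_suffix hmd)
          clear ih H hr gch rch hmd hmr c1 c2 Gd Gr n1 n2 hn
          simp only [List.nodup_cons, List.nodup_append, List.mem_append, List.mem_cons]
            at gnd rnd hT' e1 e2
          refine ⟨hch, gT, by grind, ?_⟩
          simp only [List.nodup_cons, List.nodup_append, List.mem_append, List.mem_cons]
          grind
        refine ⟨_, _, c, G2, Gr, hbc, ?_, ?_, ?_⟩ <;> grind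
      · obtain ⟨k1, k2, rfl⟩ := List.append_of_mem h3
        have G2 : Good E s T (q2 ++ y :: k2) c := by
          have hch := chain_glue c2 (chain_suffix hmr)
          clear ih H hr gch rch hmd hmr c1 c2 Gd Gr n1 n2 hn
          simp only [List.nodup_cons, List.nodup_append, List.mem_append, List.mem_cons]
            at gnd rnd hT' e1 e2
          refine ⟨hch, rT, by grind, ?_⟩
          simp only [List.nodup_cons, List.nodup_append, List.mem_append, List.mem_cons]
          grind
        refine ⟨_, _, c, Gd, G2, hbc, ?_, ?_, ?_⟩ <;> grind

theorem reach_of_chain {E : V → V → Prop} {z : V} (l : List V) : ∀ {x y : V},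
    List.IsChain E l → l.head? = some x → l.getLast? = some y → z ∉ l →
    Relation.ReflTransGen (DelVertex E z) x y := by
  induction l with
  | nil => simp
  | cons u l ih =>
    intro x y hc hx hy hz
    obtain rfl : u = x := by simpa using hx
    cases l with
    | nil =>
      obtain rfl : u = y := by simpa using hy
      exact .refl
    | cons u' l =>
      rw [List.isChain_cons_cons] at hc
      simp only [List.mem_cons, not_or] at hz
      refine Relation.ReflTransGen.head (b := u') ⟨hc.1, Ne.symm hz.1, Ne.symm hz.2.1⟩ ?_
      exact ih hc.2 rfl (by simpa using hy) (by simp [hz.2.1, hz.2.2])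

theorem reach_of_two {E : V → V → Prop} {x y z : V} (h : TwoVDP E x y) (hx : z ≠ x)
    (hy : z ≠ y) : Relation.ReflTransGen (DelVertex E z) x y := by
  obtain ⟨p, q, hp, hq, -, hd⟩ := h
  by_cases hz : z ∈ p
  · refine reach_of_chain q hq.1 hq.2.1 hq.2.2.1 fun hz' => ?_
    rcases hd z hz hz' with h | h
    · exact hx h
    · exact hy h
  · exact reach_of_chain p hp.1 hp.2.1 hp.2.2.1 hz

theorem reach_pred {E : V → V → Prop} {a b : V} (h : Relation.ReflTransGen E a b) :
    a = b ∨ ∃ y, E y b ∧ Relation.ReflTransGen (DelVertex E b) a y := by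
  induction h using Relation.ReflTransGen.head_induction_on with
  | refl => exact Or.inl rfl
  | @head a a' e _ ih =>
    by_cases hab : a = b
    · exact Or.inl hab
    right
    by_cases hb : a' = b
    · subst hb; exact ⟨a, e, .refl⟩
    · obtain ⟨y, hy, hr⟩ := ih.resolve_left hb
      exact ⟨y, hy, .head ⟨e, hab, hb⟩ hr⟩

theorem not_mem_path {E : V → V → Prop} {b : V} (m : List V) : ∀ {s c : V},
    List.IsChain E (s :: (m ++ [c])) → ¬ E s b → (∀ u ∈ m, ¬ E u b) → b ∉ m ++ [c] := by
  induction m with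
  | nil =>
    intro s c h hs _
    have h : E s c := by simpa using h
    simp only [List.nil_append, List.mem_singleton]
    rintro rfl
    exact hs h
  | cons y m ih =>
    intro s c h hs hm
    rw [List.cons_append, List.isChain_cons_cons] at h
    have := ih h.2 (hm y (by simp)) (fun u hu => hm u (by simp [hu]))
    rw [List.cons_append, List.mem_cons, not_or]
    refine ⟨?_, this⟩
    rintro rfl
    exact hs h.1

theorem dipath_of {E : V → V → Prop} {a b : V} {m : List V}
    (h : List.IsChain E (a :: (m ++ [b]))) (hn : (a :: (m ++ [b])).Nodup) :
    IsDipath E a b (a :: (m ++ [b])) :=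
  ⟨h, rfl, by rw [← List.cons_append]; exact List.getLast?_concat .., hn⟩

theorem key {E : V → V → Prop} {a b v w : V} (hirr : ∀ u, ¬ E u u) (hab : a ≠ b)
    (hav : a ≠ v) (hbv : b ≠ v) (haw : a ≠ w) (hbw : b ≠ w) (hvw : v ≠ w)
    (h1 : TwoVDP E a v) (h2 : TwoVDP E v b) (h3 : TwoVDP E a w) (h4 : TwoVDP E w b) :
    TwoVDP E a b := by
  classical
  by_cases e : E a b
  · let F : V → V → Prop := fun x y => E x y ∧ ¬ (x = a ∧ y = b)
    have r1 : Relation.ReflTransGen F a v :=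
      Relation.ReflTransGen.mono (fun x y h => ⟨h.1, fun h' => h.2.2 h'.2⟩) _ _ (reach_of_two (z := b) h1 hab.symm hbv)
    have r2 : Relation.ReflTransGen F v b :=
      Relation.ReflTransGen.mono (fun x y h => ⟨h.1, fun h' => h.2.1 h'.1⟩) _ _ (reach_of_two (z := a) h2 hav hab)
    obtain ⟨m, c, g⟩ := trunc (T := {b}) (r1.trans r2) rfl hab
    obtain rfl : c = b := g.mem
    refine ⟨a :: ([] ++ [c]), a :: (m ++ [c]), dipath_of (by simpa using e) (by simpa using hab),
      dipath_of (g.chain.imp fun _ _ h => h.1) g.nodup, ?_, ?_⟩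
    · intro h
      have hm : m = [] := by
        have := congrArg List.length h
        simp at this
        exact this
      subst hm
      have : F a c := by simpa using g.chain
      exact this.2 ⟨rfl, rfl⟩
    · intro z hz _
      simpa using hz
  · let T : Set V := {u | E u b}
    have haT : a ∉ T := e
    have reach : ∀ z, z ≠ a → z ≠ b → Relation.ReflTransGen (DelVertex E z) a b := by
      intro z hza hzb
      by_cases hzv : z = v
      · have hzw : z ≠ w := hzv ▸ hvw
        exact (reach_of_two h3 hza hzw).trans (reach_of_two h4 hzw hzb)
      · exact (reach_of_two h1 hza hzv).trans (reach_of_two h2 hzv hzb)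
    have H : ∀ z, z ≠ a → ∃ y ∈ T, Relation.ReflTransGen (DelVertex E z) a y := by
      intro z hza
      by_cases hzb : z = b
      · subst hzb
        have r : Relation.ReflTransGen E a z :=
          Relation.ReflTransGen.mono (fun _ _ h => h.1) _ _ (reach v hav.symm hbv.symm)
        exact (reach_pred r).resolve_left hab
      · rcases Relation.ReflTransGen.cases_tail (reach z hza hzb) with h | ⟨c, hc, hcb⟩
        · exact absurd h.symm hab
        · exact ⟨c, hcb.1, hc⟩
    obtain ⟨y, hy, hr⟩ := H b hab.symm
    obtain ⟨m, c, g, -⟩ := trunc_del hr hy haT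
    obtain ⟨m1, m2, d, g1, g2, hcd, hc2, hd1, hdis⟩ := fan m.length T m c le_rfl haT H g
    have b1 := not_mem_path m1 g1.chain e g1.nmem
    have b2 := not_mem_path m2 g2.chain e g2.nmem
    have t1 := g1.mem
    have t2 := g2.mem
    have n1 := g1.nodup
    have n2 := g2.nodup
    have D : ∀ (k : List V) (x : V), Good E a T k x → b ∉ k ++ [x] →
        IsDipath E a b (a :: ((k ++ [x]) ++ [b])) := by
      intro k x gk hb
      have := gk.nodup
      have := gk.mem
      refine dipath_of ?_ ?_
      · exact chain_glue (r := []) gk.chain (by have h : E x b := gk.mem; simpa using h)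
      · rw [← List.cons_append, List.nodup_append]
        refine ⟨gk.nodup, by simp, ?_⟩
        grind
    refine ⟨_, _, D m1 c g1 b1, D m2 d g2 b2, ?_, ?_⟩
    · intro h
      have : c ∈ a :: ((m2 ++ [d]) ++ [b]) := by rw [← h]; simp
      grind
    · intro z hz hz'
      simp only [List.mem_cons, List.mem_append, List.not_mem_nil, or_false] at hz hz'
      by_cases hza : z = a
      · exact Or.inl hza
      by_cases hzb : z = b
      · exact Or.inr hzb
      exfalso
      simp only [hza, hzb, false_or, or_false] at hz hz'
      rcases hz with hz | rfl <;> rcases hz' with hz' | hz'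
      · exact hdis z hz hz'
      · exact hd1 (hz' ▸ hz)
      · exact hc2 hz'
      · exact hcd hz'

theorem key_rel {E : V → V → Prop} {a b v w : V} (hirr : ∀ u, ¬ E u u) (hab : a ≠ b)
    (hvw : v ≠ w) (va : Rel2d E v a) (vb : Rel2d E v b) (wa : Rel2d E w a) (wb : Rel2d E w b) :
    Rel2d E a b :=
  ⟨hab, key hirr hab va.1.symm vb.1.symm wa.1.symm wb.1.symm hvw va.2.2 vb.2.1 wa.2.2 wb.2.1,
    key hirr hab.symm vb.1.symm va.1.symm wb.1.symm wa.1.symm hvw vb.2.2 va.2.1 wb.2.2 wa.2.1⟩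

theorem rel_symm {E : V → V → Prop} {a b : V} (h : Rel2d E a b) : Rel2d E b a :=
  ⟨h.1.symm, h.2.2, h.2.1⟩

end Aux14

/-- Lemma 21: if `v ↔² w` and `C` is the 2-directed block containing
both `v` and `w`, then `C = (N(v) ∩ N(w)) ∪ {v, w}`, where `N(u)` is the set of
vertices `z ≠ u` with `u ↔² z`. -/
theorem stmt14 {V : Type*} [Fintype V] (E : V → V → Prop)
    (hirr : ∀ u, ¬ E u u) (hsc : IsStronglyConn E) (v w : V) (hvw : Rel2d E v w)
    (C : Set V) (hC : IsMaxBlock (Rel2d E) 2 C) (hv : v ∈ C) (hw : w ∈ C) :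
    C = ({z : V | Rel2d E v z} ∩ {z : V | Rel2d E w z}) ∪ {v, w} := by
  obtain ⟨-, hcl, hmax⟩ := hC
  symm
  apply hmax
  · intro z hz
    by_cases h1 : z = v
    · right; simp [h1]
    by_cases h2 : z = w
    · right; simp [h2]
    left
    exact ⟨hcl v hv z hz (Ne.symm h1), hcl w hw z hz (Ne.symm h2)⟩
  · intro x hx y hy hxy
    rcases hx with ⟨hx1, hx2⟩ | rfl | rfl <;> rcases hy with ⟨hy1, hy2⟩ | rfl | rfl
    · exact Aux14.key_rel hirr hxy hvw.1 hx1 hy1 hx2 hy2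
    · exact Aux14.rel_symm hx1
    · exact Aux14.rel_symm hx2
    · exact hy1
    · exact absurd rfl hxy
    · exact hvw
    · exact hy2
    · exact Aux14.rel_symm hvw
    · exact absurd rfl hxy
end

section
/- Let G = (V,E) be a strongly connected finite simple directed graph on n vertices that contains at least one vertex which is not a strong articulation point of G. Then there exists an edge set E* ⊆ E with |E*| ≤ 6n − 8 such that G* = (V, E*) is strongly connected and the strong articulation points of G* are exactly the strong articulation points of G. -/
variable {V : Type*}

/-- `v` is a strong articulation point of (the strongly connected digraph) `E`:
removing `v` leaves a graph that is not strongly connected. -/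
def IsSAP (E : V → V → Prop) (v : V) : Prop :=
  ¬ ∀ a b : V, a ≠ v → b ≠ v → DiReach (DelVertex E v) a b

theorem Relation.ReflTransGen.monoR {V : Type*} {R R' : V → V → Prop} {a b : V}
    (hr : Relation.ReflTransGen R a b) (h : ∀ x y, R x y → R' x y) :
    Relation.ReflTransGen R' a b :=
  Relation.ReflTransGen.lift id h _ _ hr

/-- Cut covering condition. -/
def CutCov {V : Type*} (A : Set (Option V)) (T : Set V) (s : V) (F : Set (V × V)) : Prop :=
  ∀ o ∈ A, ∀ S : Set V, s ∉ S → (∀ z ∈ S, some z ≠ o) → (∃ t ∈ S, t ∈ T) →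
    ∃ a b, (a, b) ∈ F ∧ a ∉ S ∧ b ∈ S ∧ some a ≠ o

/-- The edge `(x, w)` is the only edge covering the cut `(o, S)`. -/
structure CutCrit {V : Type*} (A : Set (Option V)) (T : Set V) (s : V) (F : Set (V × V))
    (x w : V) (o : Option V) (S : Set V) : Prop where
  ho : o ∈ A
  hs : s ∉ S
  hS : ∀ z ∈ S, some z ≠ o
  hT : ∃ t ∈ S, t ∈ T
  hx : x ∉ S
  hw : w ∈ S
  hxo : some x ≠ o
  huniq : ∀ a b, (a, b) ∈ F → a ∉ S → b ∈ S → some a ≠ o → a = x ∧ b = w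

theorem CutCrit.tail_mem {V : Type*} {A : Set (Option V)} {T : Set V} {s : V} {F : Set (V × V)}
    {x w y : V} {o : Option V} {S : Set V} (h : CutCrit A T s F x w o S)
    (hy : (y, w) ∈ F) (hne : y ≠ x) : y ∈ S ∨ some y = o := by
  by_contra hc
  push Not at hc
  exact hne (h.huniq y w hy hc.1 h.hw hc.2).1

/-- If the union of two critical sets is a required cut w.r.t. `o`, contradiction. -/
theorem crit_union {V : Type*} {A : Set (Option V)} {T : Set V} {s : V} {F : Set (V × V)}
    {w x1 x2 : V} {o1 o2 : Option V} {S1 S2 : Set V} (hc : CutCov A T s F)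
    (h1 : CutCrit A T s F x1 w o1 S1) (h2 : CutCrit A T s F x2 w o2 S2)
    (e1 : (x1, w) ∈ F) (e2 : (x2, w) ∈ F) (hne : x1 ≠ x2) (o : Option V) (ho : o ∈ A)
    (hoS1 : ∀ z ∈ S1, some z ≠ o) (hoS2 : ∀ z ∈ S2, some z ≠ o)
    (ho1 : ∀ z, some z = o1 → z ∈ S2 ∨ some z = o)
    (ho2 : ∀ z, some z = o2 → z ∈ S1 ∨ some z = o) : False := by
  obtain ⟨t, ht, htT⟩ := h1.hT
  obtain ⟨a, b, hab, ha, hb, hao⟩ := hc o ho (S1 ∪ S2)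
    (by rintro (h | h); exacts [h1.hs h, h2.hs h])
    (by rintro z (h | h); exacts [hoS1 z h, hoS2 z h]) ⟨t, Or.inl ht, htT⟩
  have ha1 : a ∉ S1 := fun h => ha (Or.inl h)
  have ha2 : a ∉ S2 := fun h => ha (Or.inr h)
  have hao1 : some a ≠ o1 := fun h => (ho1 a h).elim ha2 hao
  have hao2 : some a ≠ o2 := fun h => (ho2 a h).elim ha1 hao
  rcases hb with hb | hb
  · obtain ⟨rfl, rfl⟩ := h1.huniq a b hab ha1 hb hao1
    exact (h2.tail_mem e1 hne).elim ha2 hao2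
  · obtain ⟨rfl, rfl⟩ := h2.huniq a b hab ha2 hb hao2
    exact (h1.tail_mem e2 hne.symm).elim ha1 hao1

theorem crit_pair {V : Type*} {A : Set (Option V)} {T : Set V} {s : V} {F : Set (V × V)}
    {w x1 x2 : V} {o1 o2 : Option V} {S1 S2 : Set V} (hn : none ∈ A) (hc : CutCov A T s F)
    (h1 : CutCrit A T s F x1 w o1 S1) (h2 : CutCrit A T s F x2 w o2 S2)
    (e1 : (x1, w) ∈ F) (e2 : (x2, w) ∈ F) (hne : x1 ≠ x2) :
    o1 ≠ none ∧ o1 ≠ o2 ∧ (∀ z ∈ S2, some z ≠ o1) ∧ (∀ z ∈ S1, some z ≠ o2) := by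
  have key := crit_union hc h1 h2 e1 e2 hne
  have hS1 := h1.hS
  have hS2 := h2.hS
  have hA1 := h1.ho
  have hA2 := h2.ho
  have k0 := key none hn
  have k1 := key o1 hA1
  have k2 := key o2 hA2
  clear key
  rcases o1 with _ | u1 <;> rcases o2 with _ | u2 <;> simp_all <;> grind

theorem crit_triple {V : Type*} {A : Set (Option V)} {T : Set V} {s : V} {F : Set (V × V)}
    {w x1 x2 x3 : V} {o1 o2 o3 : Option V} {S1 S2 S3 : Set V} (hn : none ∈ A)
    (hc : CutCov A T s F)
    (h1 : CutCrit A T s F x1 w o1 S1) (h2 : CutCrit A T s F x2 w o2 S2)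
    (h3 : CutCrit A T s F x3 w o3 S3)
    (e1 : (x1, w) ∈ F) (e2 : (x2, w) ∈ F) (e3 : (x3, w) ∈ F)
    (h12 : x1 ≠ x2) (h13 : x1 ≠ x3) (h23 : x2 ≠ x3) : False := by
  obtain ⟨-, o12, p12, p21⟩ := crit_pair hn hc h1 h2 e1 e2 h12
  obtain ⟨-, o13, p13, p31⟩ := crit_pair hn hc h1 h3 e1 e3 h13
  obtain ⟨-, o23, p23, p32⟩ := crit_pair hn hc h2 h3 e2 e3 h23
  have t12 := h1.tail_mem e2 h12.symm
  have t13 := h1.tail_mem e3 h13.symm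
  have t21 := h2.tail_mem e1 h12
  have t23 := h2.tail_mem e3 h23.symm
  have t31 := h3.tail_mem e1 h13
  have t32 := h3.tail_mem e2 h23
  have hx1 : x1 ∈ S2 ∩ S3 := by constructor <;> grind
  have hx2 : x2 ∈ S1 := by grind
  have hx3 : x3 ∈ S1 := by grind
  obtain ⟨t, ht, htT⟩ := h1.hT
  obtain ⟨a, b, hab, ha, hb, hao⟩ := hc o1 h1.ho (S1 ∪ (S2 ∩ S3))
    (by rintro (h | h); exacts [h1.hs h, h2.hs h.1])
    (by rintro z (h | h); exacts [h1.hS z h, p12 z h.1]) ⟨t, Or.inl ht, htT⟩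
  have ha1 : a ∉ S1 := fun h => ha (Or.inl h)
  have ha2 : a ∉ S2 ∩ S3 := fun h => ha (Or.inr h)
  rcases hb with hb | hb
  · obtain ⟨rfl, rfl⟩ := h1.huniq a b hab ha1 hb hao
    exact ha2 hx1
  · have q2 := h2.huniq a b hab
    have q3 := h3.huniq a b hab
    have hb2 := hb.1
    have hb3 := hb.2
    have : a ∉ S2 ∨ a ∉ S3 := by
      by_contra hcon; push Not at hcon; exact ha2 hcon
    have n2 : a ≠ x2 := fun h => ha1 (h ▸ hx2)
    have n3 : a ≠ x3 := fun h => ha1 (h ▸ hx3)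
    have r2 : a ∉ S2 → some a = o2 := fun h => by
      by_contra hcon; exact n2 (q2 h hb2 hcon).1
    have r3 : a ∉ S3 → some a = o3 := fun h => by
      by_contra hcon; exact n3 (q3 h hb3 hcon).1
    have := p23 a
    have := p32 a
    by_cases m2 : a ∈ S2 <;> by_cases m3 : a ∈ S3 <;> grind

theorem exists_minimal_cov {V : Type*} [Finite V] {A : Set (Option V)} {T : Set V} {s : V}
    {E : Set (V × V)} (hc : CutCov A T s E) :
    ∃ F ⊆ E, CutCov A T s F ∧
      ∀ x w, (x, w) ∈ F → ∃ o S, CutCrit A T s F x w o S := by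
  obtain ⟨F, hFE, hF⟩ := (Set.toFinite {F : Set (V × V) | CutCov A T s F}).exists_le_minimal hc
  refine ⟨F, hFE, hF.1, fun x w hxw => ?_⟩
  have hnot : ¬ CutCov A T s (F \ {(x, w)}) := by
    intro h
    have := hF.2 h Set.sdiff_subset hxw
    exact this.2 rfl
  unfold CutCov at hnot
  push Not at hnot
  obtain ⟨o, ho, S, hs, hS, hT, hno⟩ := hnot
  have hu : ∀ a b, (a, b) ∈ F → a ∉ S → b ∈ S → some a ≠ o → a = x ∧ b = w := by
    intro a b hab ha hb hao
    by_contra hcon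
    exact hao (hno a b ⟨hab, by simpa using hcon⟩ ha hb)
  obtain ⟨a, b, hab, ha, hb, hao⟩ := hF.1 o ho S hs hS hT
  obtain ⟨rfl, rfl⟩ := hu a b hab ha hb hao
  exact ⟨o, S, ho, hs, hS, hT, ha, hb, hao, hu⟩

theorem card_of_indeg {V : Type*} [Fintype V] (F : Set (V × V)) (H : Finset V) (k : ℕ)
    (hH : ∀ x w, (x, w) ∈ F → w ∈ H)
    (hk : ∀ w, {x | (x, w) ∈ F}.ncard ≤ k) : F.ncard ≤ k * H.card := by
  classical
  rw [Set.ncard_eq_toFinset_card' F]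
  refine Finset.card_le_mul_card_image_of_maps_to (f := Prod.snd) ?_ k ?_
  · rintro ⟨x, w⟩ h
    exact hH x w (by simpa using h)
  · intro w _
    refine le_trans ?_ (hk w)
    rw [Set.ncard_eq_toFinset_card' {x | (x, w) ∈ F}]
    refine Finset.card_le_card_of_injOn Prod.fst ?_ ?_
    · rintro ⟨x, y⟩ h
      simp at h ⊢
      obtain ⟨h, rfl⟩ := h
      exact h
    · rintro ⟨x, y⟩ h ⟨x', y'⟩ h' hh
      simp at h h' hh ⊢
      exact ⟨hh, h.2.trans h'.2.symm⟩

theorem sparse_two {V : Type*} [Fintype V] {A : Set (Option V)} {T : Set V} {s : V}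
    {E : Set (V × V)} (hn : none ∈ A) (hc : CutCov A T s E) :
    ∃ F ⊆ E, CutCov A T s F ∧ F.ncard ≤ 2 * (Fintype.card V - 1) := by
  classical
  obtain ⟨F, hFE, hF, hcrit⟩ := exists_minimal_cov hc
  refine ⟨F, hFE, hF, ?_⟩
  have := card_of_indeg F (Finset.univ.erase s) 2 ?_ ?_
  · simpa [Finset.card_erase_of_mem] using this
  · intro x w h
    obtain ⟨o, S, hh⟩ := hcrit x w h
    simp only [Finset.mem_erase, Finset.mem_univ, and_true]
    rintro rfl
    exact hh.hs hh.hw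
  · intro w
    by_contra hcon
    push Not at hcon
    obtain ⟨a, b, c, ha, hb, hcc, hab, hac, hbc⟩ := (Set.two_lt_ncard_iff (Set.toFinite _)).1 hcon
    obtain ⟨o1, S1, h1⟩ := hcrit a w ha
    obtain ⟨o2, S2, h2⟩ := hcrit b w hb
    obtain ⟨o3, S3, h3⟩ := hcrit c w hcc
    exact crit_triple hn hF h1 h2 h3 ha hb hcc hab hac hbc

theorem sparse_one {V : Type*} [Fintype V] {T : Set V} {s v : V} (hsv : s ≠ v)
    {E : Set (V × V)} (hv : ∀ x, (x, v) ∉ E) (hc : CutCov {none} T s E) :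
    ∃ F ⊆ E, CutCov {none} T s F ∧ F.ncard ≤ Fintype.card V - 2 := by
  classical
  obtain ⟨F, hFE, hF, hcrit⟩ := exists_minimal_cov hc
  refine ⟨F, hFE, hF, ?_⟩
  have := card_of_indeg F ((Finset.univ.erase s).erase v) 1 ?_ ?_
  · rw [Finset.card_erase_of_mem (by simp [hsv.symm]), Finset.card_erase_of_mem (by simp),
      Finset.card_univ] at this
    omega
  · intro x w h
    obtain ⟨o, S, hh⟩ := hcrit x w h
    simp only [Finset.mem_erase, Finset.mem_univ, and_true]
    constructor
    · rintro rfl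
      exact hv x (hFE h)
    · rintro rfl
      exact hh.hs hh.hw
  · intro w
    by_contra hcon
    push Not at hcon
    obtain ⟨a, b, ha, hb, hab⟩ := (Set.one_lt_ncard_iff (Set.toFinite _)).1 hcon
    obtain ⟨o1, S1, h1⟩ := hcrit a w ha
    obtain ⟨o2, S2, h2⟩ := hcrit b w hb
    exact (crit_pair (Set.mem_singleton none) hF h1 h2 ha hb hab).1 h1.ho

/-- Avoiding relation. -/
def AvoidRel {V : Type*} (F : Set (V × V)) (o : Option V) (a b : V) : Prop :=
  (a, b) ∈ F ∧ some a ≠ o ∧ some b ≠ o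

theorem cov_of_reach {V : Type*} {A : Set (Option V)} {T : Set V} {s : V} {F : Set (V × V)}
    (h : ∀ o ∈ A, ∀ t ∈ T, some t ≠ o → Relation.ReflTransGen (AvoidRel F o) s t) :
    CutCov A T s F := by
  rintro o ho S hs hS ⟨t, htS, htT⟩
  have hr := h o ho t htT (hS t htS)
  by_contra hcon
  push Not at hcon
  have : ∀ y, Relation.ReflTransGen (AvoidRel F o) s y → y ∉ S := by
    intro y hy
    induction hy with
    | refl => exact hs
    | tail _ hbc ih => exact fun hm => hbc.2.1 (hcon _ _ hbc.1 ih hm)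
  exact this t hr htS

theorem reach_of_cov {V : Type*} {A : Set (Option V)} {T : Set V} {s : V} {F : Set (V × V)}
    (h : CutCov A T s F) (o : Option V) (ho : o ∈ A) (t : V) (ht : t ∈ T)
    (hto : some t ≠ o) : Relation.ReflTransGen (AvoidRel F o) s t := by
  by_contra hcon
  obtain ⟨a, b, hab, ha, hb, hao⟩ := h o ho
    {y | ¬ Relation.ReflTransGen (AvoidRel F o) s y ∧ some y ≠ o}
    (fun hh => hh.1 .refl) (fun z hz => hz.2) ⟨t, ⟨hcon, hto⟩, ht⟩
  have hra : Relation.ReflTransGen (AvoidRel F o) s a := by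
    by_contra hc
    exact ha ⟨hc, hao⟩
  exact hb.1 (hra.tail ⟨hab, hao, hb.2⟩)

/-- One direction of the construction. -/
theorem one_side {V : Type*} [Fintype V] (E : V → V → Prop) (hsc : IsStronglyConn E) (v r : V)
    (hrv : r ≠ v) (hv : ¬ IsSAP E v) :
    ∃ F : Set (V × V), F ⊆ {e : V × V | E e.1 e.2} ∧
      F.ncard ≤ 2 * (Fintype.card V - 1) + (Fintype.card V - 2) ∧
      (∀ t, DiReach (fun a b : V => (a, b) ∈ F) v t) ∧
      (∀ u, u ≠ v → ¬ IsSAP E u → ∀ t, t ≠ u →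
        DiReach (DelVertex (fun a b : V => (a, b) ∈ F) u) v t) ∧
      (∀ t, t ≠ v → DiReach (DelVertex (fun a b : V => (a, b) ∈ F) v) r t) := by
  let A : Set (Option V) := {o | ∀ u, o = some u → u ≠ v ∧ ¬ IsSAP E u}
  have hnA : none ∈ A := by intro u hu; simp at hu
  have c1 : CutCov A Set.univ v {e : V × V | E e.1 e.2} := by
    apply cov_of_reach
    intro o ho t _ hto
    rcases o with _ | u
    · exact (hsc v t).monoR (fun a b h => ⟨h, by simp, by simp⟩)
    · obtain ⟨huv, hu⟩ := ho u rfl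
      unfold IsSAP at hu
      rw [not_not] at hu
      exact (hu v t huv.symm (by simpa using hto)).monoR
        (fun a b h => ⟨h.1, by simpa using h.2.1, by simpa using h.2.2⟩)
  have c2 : CutCov {none} {v}ᶜ r {e : V × V | DelVertex E v e.1 e.2} := by
    apply cov_of_reach
    rintro o rfl t ht hto
    unfold IsSAP at hv
    rw [not_not] at hv
    exact (hv r t hrv ht).monoR (fun a b h => ⟨h, by simp, by simp⟩)
  obtain ⟨F1, hF1, k1, n1⟩ := sparse_two hnA c1
  obtain ⟨F2, hF2, k2, n2⟩ := sparse_one hrv (by intro x hx; exact hx.2.2 rfl) c2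
  refine ⟨F1 ∪ F2, ?_, ?_, ?_, ?_, ?_⟩
  · rintro e (h | h)
    · exact hF1 h
    · exact (hF2 h).1
  · exact (Set.ncard_union_le _ _).trans (by omega)
  · intro t
    exact (reach_of_cov k1 none hnA t trivial (by simp)).monoR (fun a b h => Or.inl h.1)
  · intro u huv hu t htu
    refine (reach_of_cov k1 (some u) ?_ t trivial (by simpa using htu)).monoR
      (fun a b h => ⟨Or.inl h.1, by simpa using h.2.1, by simpa using h.2.2⟩)
    intro u' hu'
    obtain rfl : u = u' := by simpa using hu'
    exact ⟨huv, hu⟩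
  · intro t ht
    exact (reach_of_cov k2 none rfl t ht (by simp)).monoR
      (fun a b h => ⟨Or.inr h.1, (hF2 h.1).2.1, (hF2 h.1).2.2⟩)

theorem reach_swap {V : Type*} {R R' : V → V → Prop} (h : ∀ a b, R a b → R' b a) {a b : V}
    (hr : DiReach R a b) : DiReach R' b a := by
  unfold DiReach at *
  rw [← Relation.reflTransGen_swap]
  exact hr.monoR h

/-- a strongly connected finite simple digraph on `n` vertices with
at least one vertex that is not a strong articulation point has a strongly connected
spanning subgraph with at most `6n − 8` edges and exactly the same strong articulation
points. -/
theorem stmt15 {V : Type*} [Fintype V] (E : V → V → Prop)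
    (hirr : ∀ v, ¬ E v v) (hsc : IsStronglyConn E)
    (hex : ∃ v : V, ¬ IsSAP E v) :
    ∃ E' : Set (V × V), E' ⊆ {e : V × V | E e.1 e.2} ∧
      E'.ncard ≤ 6 * Fintype.card V - 8 ∧
      IsStronglyConn (fun a b : V => (a, b) ∈ E') ∧
      ∀ u : V, (IsSAP (fun a b : V => (a, b) ∈ E') u ↔ IsSAP E u) := by
  obtain ⟨v, hv⟩ := hex
  by_cases hr : ∃ r, r ≠ v
  swap
  · push Not at hr
    have hall : ∀ a b : V, a = b := fun a b => (hr a).trans (hr b).symm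
    refine ⟨∅, by simp, by simp, ?_, ?_⟩
    · intro a b
      rw [hall a b]
      exact Relation.ReflTransGen.refl
    · intro u
      constructor <;> intro h <;> exact (h fun a b ha _ => (ha (hall _ _)).elim).elim
  obtain ⟨r, hrv⟩ := hr
  have hcard : 2 ≤ Fintype.card V := by
    have : Nontrivial V := ⟨r, v, hrv⟩
    exact Fintype.one_lt_card
  have hsapswap : ∀ u, ¬ IsSAP E u → ¬ IsSAP (fun a b => E b a) u := by
    intro u hu
    unfold IsSAP at *
    rw [not_not] at *
    intro a b ha hb
    exact reach_swap (fun x y h => ⟨h.1, h.2.2, h.2.1⟩) (hu b a hb ha)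
  obtain ⟨F, hFE, hFn, f1, f2, f3⟩ := one_side E hsc v r hrv hv
  obtain ⟨B, hBE, hBn, b1, b2, b3⟩ := one_side (fun a b => E b a)
    (fun a b => reach_swap (fun x y h => h) (hsc b a)) v r hrv (hsapswap v hv)
  refine ⟨F ∪ (Set.image Prod.swap B), ?_, ?_, ?_, ?_⟩
  · rintro e (h | ⟨e, h, rfl⟩)
    · exact hFE h
    · exact hBE h
  · have h1 := Set.ncard_union_le F ((Set.image Prod.swap B))
    have h2 : ((Set.image Prod.swap B)).ncard ≤ B.ncard := Set.ncard_image_le (Set.toFinite _)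
    omega
  · intro x y
    exact (reach_swap (fun a b h => Or.inr ⟨_, h, rfl⟩) (b1 x)).trans
      ((f1 y).monoR fun a b h => Or.inl h)
  · intro u
    constructor
    · intro h
      by_contra hu
      apply h
      intro a b ha hb
      by_cases huv : u = v
      · subst huv
        exact (reach_swap (fun x y h => ⟨Or.inr ⟨_, h.1, rfl⟩, h.2.2, h.2.1⟩) (b3 a ha)).trans
          ((f3 b hb).monoR fun x y h => ⟨Or.inl h.1, h.2⟩)
      · exact (reach_swap (fun x y h => ⟨Or.inr ⟨_, h.1, rfl⟩, h.2.2, h.2.1⟩)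
          (b2 u huv (hsapswap u hu) a ha)).trans
          ((f2 u huv hu b hb).monoR fun x y h => ⟨Or.inl h.1, h.2⟩)
    · intro h hcon
      apply h
      intro a b ha hb
      refine (hcon a b ha hb).monoR fun x y hxy => ⟨?_, hxy.2⟩
      rcases hxy.1 with h' | ⟨⟨p, q⟩, h', he⟩
      · exact hFE h'
      · simp only [Prod.swap_prod_mk, Prod.mk.injEq] at he
        obtain ⟨rfl, rfl⟩ := he
        exact hBE h'
end

section
/- Let G = (V,E) be a finite simple directed graph, let k ≥ 1, and let x, y be distinct vertices of G. Then x ↔^{ks} y holds if and only if one of the following four conditions is satisfied: (1) both (x,y) ∈ E and (y,x) ∈ E; (2) (x,y) ∈ E, (y,x) ∉ E, and there exist k pairwise vertex-disjoint paths from y to x in G; (3) (y,x) ∈ E, (x,y) ∉ E, and there exist k pairwise vertex-disjoint paths from x to y in G; (4) neither (x,y) nor (y,x) is in E, and there exist k pairwise vertex-disjoint paths from x to y and k pairwise vertex-disjoint paths from y to x in G. -/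
variable {V : Type*}

/-- There are `k` pairwise (internally) vertex-disjoint paths from `x` to `y`:
`k` pairwise distinct paths, any two of which share no vertices other than `x` and
`y`. -/
def KVDP (E : V → V → Prop) (k : ℕ) (x y : V) : Prop :=
  ∃ P : Fin k → List V, (∀ i, IsDipath E x y (P i)) ∧
    ∀ i j, i ≠ j → P i ≠ P j ∧ ∀ z, z ∈ P i → z ∈ P j → z = x ∨ z = y

/-- `x ↔^{ks} y` : for every set `X ⊆ V \ {x,y}` with `|X| < k`, the vertices `x` and
`y` lie in the same SCC of `G − X`. -/
def RelKs (E : V → V → Prop) (k : ℕ) (x y : V) : Prop :=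
  ∀ X : Set V, x ∉ X → y ∉ X → X.ncard < k →
    InSameSCC (fun a b => E a b ∧ a ∉ X ∧ b ∉ X) x y

theorem rtg_mono {V : Type*} {r s : V → V → Prop} {a b : V} (h : Relation.ReflTransGen r a b)
    (hrs : ∀ p q, r p q → s p q) : Relation.ReflTransGen s a b := by
  induction h with
  | refl => exact .refl
  | tail _ h2 ih => exact ih.tail (hrs _ _ h2)

/-- `C` carries a directed connection from `a` to `b`: inside `C`, never leaving `b` and never
entering `a`, every vertex is reachable from `a` and reaches `b`. -/
def MConn {V : Type*} (E : Finset (V × V)) (a b : V) (C : Set V) : Prop :=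
  a ∈ C ∧ b ∈ C ∧ ∀ z ∈ C,
    Relation.ReflTransGen (fun p q => (p, q) ∈ E ∧ p ∈ C ∧ q ∈ C ∧ p ≠ b ∧ q ≠ a) a z ∧
    Relation.ReflTransGen (fun p q => (p, q) ∈ E ∧ p ∈ C ∧ q ∈ C ∧ p ≠ b ∧ q ≠ a) z b

/-- `S` separates `A` from `B`. -/
def MSep {V : Type*} (E : Finset (V × V)) (A B S : Finset V) : Prop :=
  ∀ a ∈ A, ∀ b ∈ B, Relation.ReflTransGen (fun p q => (p, q) ∈ E ∧ p ∉ S) a b → b ∈ S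

theorem rtg_shift {V : Type*} (E : Finset (V × V)) (S : Finset V) {z b : V} (hz : z ∉ S)
    (h : Relation.ReflTransGen (fun p q => (p, q) ∈ E ∧ q ∉ S) z b) :
    Relation.ReflTransGen (fun p q => (p, q) ∈ E ∧ p ∉ S) z b ∧ b ∉ S := by
  induction h with
  | refl => exact ⟨.refl, hz⟩
  | tail _ h2 ih => exact ⟨ih.1.tail ⟨h2.1, ih.2⟩, h2.2⟩

theorem MConn.mono {V : Type*} {E F : Finset (V × V)} (h : E ⊆ F) {a b : V} {C : Set V}
    (hc : MConn E a b C) : MConn F a b C := by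
  refine ⟨hc.1, hc.2.1, fun z hz => ⟨rtg_mono (hc.2.2 z hz).1 ?_, rtg_mono (hc.2.2 z hz).2 ?_⟩⟩
  · exact fun p q hpq => ⟨h hpq.1, hpq.2⟩
  · exact fun p q hpq => ⟨h hpq.1, hpq.2⟩

theorem MConn.comb {V : Type*} {E : Finset (V × V)} {a s t b : V} {P Q : Set V}
    (hP : MConn E a s P) (hQ : MConn E t b Q)
    (hPQ : ∀ z, z ∈ P → z ∈ Q → z = s ∧ z = t)
    (hst : s = t ∨ ((s, t) ∈ E ∧ s ∉ Q ∧ t ∉ P)) : MConn E a b (P ∪ Q) := by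
  obtain ⟨haP, hsP, hP3⟩ := hP
  obtain ⟨htQ, hbQ, hQ3⟩ := hQ
  set r := (fun p q => (p, q) ∈ E ∧ p ∈ P ∪ Q ∧ q ∈ P ∪ Q ∧ p ≠ b ∧ q ≠ a) with hr
  have m1 : ∀ p q, ((p, q) ∈ E ∧ p ∈ P ∧ q ∈ P ∧ p ≠ s ∧ q ≠ a) → r p q := by
    rintro p q ⟨h1, h2, h3, h4, h5⟩
    refine ⟨h1, Or.inl h2, Or.inl h3, ?_, h5⟩
    rintro rfl
    exact h4 (hPQ _ h2 hbQ).1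
  have m2 : ∀ p q, ((p, q) ∈ E ∧ p ∈ Q ∧ q ∈ Q ∧ p ≠ b ∧ q ≠ t) → r p q := by
    rintro p q ⟨h1, h2, h3, h4, h5⟩
    refine ⟨h1, Or.inr h2, Or.inr h3, h4, ?_⟩
    rintro rfl
    exact h5 (hPQ _ haP h3).2
  have m3 : Relation.ReflTransGen r s t := by
    rcases hst with rfl | ⟨h1, h2, h3⟩
    · exact .refl
    · refine .single ⟨h1, Or.inl hsP, Or.inr htQ, ?_, ?_⟩
      · rintro rfl; exact h2 hbQ
      · rintro rfl; exact h3 haP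
  refine ⟨Or.inl haP, Or.inr hbQ, ?_⟩
  rintro z (hz | hz)
  · exact ⟨rtg_mono (hP3 z hz).1 m1, ((rtg_mono (hP3 z hz).2 m1).trans m3).trans (rtg_mono (hQ3 t htQ).2 m2)⟩
  · exact ⟨((rtg_mono (hP3 s hsP).1 m1).trans m3).trans (rtg_mono (hQ3 z hz).1 m2), rtg_mono (hQ3 z hz).2 m2⟩

theorem sep_left {V : Type*} [DecidableEq V] {E : Finset (V × V)} {u v : V} {A B S T : Finset V}
    (hS : MSep E A B S) (hT : MSep E A (insert u S) T) : MSep (insert (u, v) E) A B T := by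
  intro a ha b hb hab
  by_contra hbT
  have key : ∀ z, Relation.ReflTransGen (fun p q => (p, q) ∈ insert (u, v) E ∧ p ∉ T) a z →
      (Relation.ReflTransGen (fun p q => (p, q) ∈ E ∧ p ∉ T) a z ∧
        Relation.ReflTransGen (fun p q => (p, q) ∈ E ∧ p ∉ S) a z) := by
    intro z hz
    induction hz with
    | refl => exact ⟨.refl, .refl⟩
    | @tail y z _ h2 ih =>
      have hy : y ∉ insert u S := fun hy => h2.2 (hT a ha y hy ih.1)
      rw [Finset.mem_insert, not_or] at hy
      have hE : (y, z) ∈ E := by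
        have := h2.1
        rw [Finset.mem_insert] at this
        rcases this with h | h
        · exact absurd (Prod.mk.inj h).1 hy.1
        · exact h
      exact ⟨ih.1.tail ⟨hE, h2.2⟩, ih.2.tail ⟨hE, hy.2⟩⟩
  obtain ⟨h1, h2⟩ := key b hab
  exact hbT (hT a ha b (Finset.mem_insert_of_mem (hS a ha b hb h2)) h1)

theorem sep_right {V : Type*} [DecidableEq V] {E : Finset (V × V)} {u v : V} {A B S T : Finset V}
    (hS : MSep E A B S) (hT : MSep E (insert v S) B T) : MSep (insert (u, v) E) A B T := by
  intro a ha b hb hab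
  by_contra hbT
  have key : ∀ z, Relation.ReflTransGen (fun p q => (p, q) ∈ insert (u, v) E ∧ p ∉ T) z b →
      (Relation.ReflTransGen (fun p q => (p, q) ∈ E ∧ p ∉ T) z b ∧
        Relation.ReflTransGen (fun p q => (p, q) ∈ E ∧ q ∉ S) z b) := by
    intro z hz
    induction hz using Relation.ReflTransGen.head_induction_on with
    | refl => exact ⟨.refl, .refl⟩
    | @head y z h2 _ ih =>
      have hy : z ∉ insert v S := fun hy => hbT (hT z hy b hb ih.1)
      rw [Finset.mem_insert, not_or] at hy
      have hE : (y, z) ∈ E := by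
        have := h2.1
        rw [Finset.mem_insert] at this
        rcases this with h | h
        · exact absurd (Prod.mk.inj h).2 hy.1
        · exact h
      exact ⟨ih.1.head ⟨hE, h2.2⟩, ih.2.head ⟨hE, hy.2⟩⟩
  obtain ⟨h1, h2⟩ := key a hab
  by_cases haS : a ∈ S
  · exact hbT (hT a (Finset.mem_insert_of_mem haS) b hb h1)
  · obtain ⟨h3, h4⟩ := rtg_shift E S haS h2
    exact h4 (hS a ha b hb h3)

theorem fin_surj {V : Type*} {k : ℕ} {T : Finset V} (hT : T.card = k) (s : Fin k → V)
    (hs : ∀ i, s i ∈ T) (hinj : Function.Injective s) : ∀ x ∈ T, ∃ i, s i = x := by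
  classical
  have : Finset.univ.image s = T := by
    apply Finset.eq_of_subset_of_card_le
    · intro x hx
      obtain ⟨i, -, rfl⟩ := Finset.mem_image.1 hx
      exact hs i
    · rw [Finset.card_image_of_injective _ hinj, hT]; simp
  intro x hx
  rw [← this] at hx
  obtain ⟨i, -, h⟩ := Finset.mem_image.1 hx
  exact ⟨i, h⟩

/-- Menger's theorem, set version. -/
theorem menger_sets {V : Type*} [DecidableEq V] (E : Finset (V × V)) :
    ∀ (k : ℕ) (A B : Finset V), (∀ S, MSep E A B S → k ≤ S.card) →
    ∃ (a b : Fin k → V) (C : Fin k → Set V), (∀ i, a i ∈ A) ∧ (∀ i, b i ∈ B) ∧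
      (∀ i, MConn E (a i) (b i) (C i)) ∧ ∀ i j z, z ∈ C i → z ∈ C j → i = j := by
  induction E using Finset.induction_on with
  | empty =>
    intro k A B h
    have hk : k ≤ (A ∩ B).card := by
      apply h
      intro a ha b hb hab
      have : a = b := by
        induction hab with
        | refl => rfl
        | tail _ h2 _ => simp at h2
      subst this
      exact Finset.mem_inter.2 ⟨ha, hb⟩
    obtain ⟨T, hT, hTk⟩ := Finset.exists_subset_card_eq hk
    let e := (Finset.equivFinOfCardEq hTk).symm
    refine ⟨fun i => e i, fun i => e i, fun i => {(e i : V)}, ?_, ?_, ?_, ?_⟩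
    · exact fun i => (Finset.mem_inter.1 (hT (e i).2)).1
    · exact fun i => (Finset.mem_inter.1 (hT (e i).2)).2
    · intro i
      refine ⟨rfl, rfl, ?_⟩
      rintro z rfl
      exact ⟨.refl, .refl⟩
    · rintro i j z h1 h2
      have h3 : (e i : V) = e j := h1.symm.trans h2
      exact e.injective (Subtype.ext h3)
  | insert e E he ih =>
    obtain ⟨u, v⟩ := e
    intro k A B h
    by_cases hS : ∀ S, MSep E A B S → k ≤ S.card
    · obtain ⟨a, b, C, h1, h2, h3, h4⟩ := ih k A B hS
      exact ⟨a, b, C, h1, h2, fun i => (h3 i).mono (Finset.subset_insert _ _), h4⟩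
    push Not at hS
    obtain ⟨S, hS, hSk⟩ := hS
    have cu : k ≤ (insert u S).card := h _ (sep_left hS (fun _ _ b hb _ => hb))
    have cv : k ≤ (insert v S).card := by
      refine h _ (sep_right hS ?_)
      intro a ha b hb hab
      by_contra hbS
      rcases Relation.ReflTransGen.cases_head hab with rfl | ⟨c, hc, _⟩
      · exact hbS ha
      · exact hc.2 ha
    have huS : u ∉ S := by
      intro hu; rw [Finset.insert_eq_of_mem hu] at cu; omega
    have hvS : v ∉ S := by
      intro hu; rw [Finset.insert_eq_of_mem hu] at cv; omega
    have cu' : (insert u S).card = k := by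
      have := Finset.card_insert_le u S; omega
    have cv' : (insert v S).card = k := by
      have := Finset.card_insert_le v S; omega
    obtain ⟨a, s, P, ha, hs, hP, hPd⟩ := ih k A (insert u S) (fun T hT => h T (sep_left hS hT))
    obtain ⟨t, b, Q, ht, hb, hQ, hQd⟩ := ih k (insert v S) B (fun T hT => h T (sep_right hS hT))
    have sinj : Function.Injective s := fun i j hij =>
      hPd i j (s i) (hP i).2.1 (by rw [hij]; exact (hP j).2.1)
    have tinj : Function.Injective t := fun i j hij =>
      hQd i j (t i) (hQ i).1 (by rw [hij]; exact (hQ j).1)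
    have ssurj := fin_surj cu' s hs sinj
    have tsurj := fin_surj cv' t ht tinj
    have hPs : ∀ i z, z ∈ P i → z ∈ insert u S → z = s i := by
      intro i z hz hzS
      obtain ⟨j, rfl⟩ := ssurj z hzS
      rw [hPd i j _ hz (hP j).2.1]
    have hQt : ∀ i z, z ∈ Q i → z ∈ insert v S → z = t i := by
      intro i z hz hzS
      obtain ⟨j, rfl⟩ := tsurj z hzS
      rw [hQd i j _ hz (hQ j).1]
    have hPQ : ∀ i j z, z ∈ P i → z ∈ Q j → z ∈ S ∧ z = s i ∧ z = t j := by
      intro i j z hzP hzQ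
      have hz : z ∈ S := by
        by_contra hz
        have w1 : Relation.ReflTransGen (fun p q => (p, q) ∈ E ∧ p ∉ S) (a i) z := by
          refine rtg_mono ((hP i).2.2 z hzP).1 ?_
          rintro p q ⟨h1, h2, h3, h4, h5⟩
          exact ⟨h1, fun hp => h4 (hPs i p h2 (Finset.mem_insert_of_mem hp))⟩
        have w2 : Relation.ReflTransGen (fun p q => (p, q) ∈ E ∧ q ∉ S) z (b j) := by
          refine rtg_mono ((hQ j).2.2 z hzQ).2 ?_
          rintro p q ⟨h1, h2, h3, h4, h5⟩
          exact ⟨h1, fun hp => h5 (hQt j q h3 (Finset.mem_insert_of_mem hp))⟩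
        obtain ⟨w3, w4⟩ := rtg_shift E S hz w2
        exact w4 (hS _ (ha i) _ (hb j) (w1.trans w3))
      exact ⟨hz, hPs i z hzP (Finset.mem_insert_of_mem hz),
        hQt j z hzQ (Finset.mem_insert_of_mem hz)⟩
    have hσ : ∀ i, ∃ j, (s i ∈ S ∧ t j = s i) ∨ (s i = u ∧ t j = v) := by
      intro i
      rcases Finset.mem_insert.1 (hs i) with h1 | h1
      · obtain ⟨j, hj⟩ := tsurj v (Finset.mem_insert_self _ _)
        exact ⟨j, Or.inr ⟨h1, hj⟩⟩
      · obtain ⟨j, hj⟩ := tsurj (s i) (Finset.mem_insert_of_mem h1)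
        exact ⟨j, Or.inl ⟨h1, hj⟩⟩
    choose σ hσ using hσ
    have cross : ∀ i j z, z ∈ P i → z ∈ Q (σ j) → i = j := by
      intro i j z h1 h2
      obtain ⟨hz, e1, e2⟩ := hPQ i (σ j) z h1 h2
      apply sinj
      rcases hσ j with h3 | h3
      · rw [← e1, e2, h3.2]
      · exact absurd (e2.trans h3.2 ▸ hz) hvS
    refine ⟨a, fun i => b (σ i), fun i => P i ∪ Q (σ i), ha, fun i => hb _, ?_, ?_⟩
    · intro i
      refine MConn.comb ((hP i).mono (Finset.subset_insert _ _))
        ((hQ (σ i)).mono (Finset.subset_insert _ _)) (fun z h1 h2 => (hPQ _ _ z h1 h2).2) ?_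
      rcases hσ i with h1 | h1
      · exact Or.inl h1.2.symm
      · refine Or.inr ⟨?_, ?_, ?_⟩
        · rw [h1.1, h1.2]; exact Finset.mem_insert_self _ _
        · intro h2
          have := (hPQ _ _ _ (hP i).2.1 h2).1
          rw [h1.1] at this
          exact huS this
        · intro h2
          have := (hPQ _ _ _ h2 (hQ (σ i)).1).1
          rw [h1.2] at this
          exact hvS this
    · rintro i j z (h1 | h1) (h2 | h2)
      · exact hPd i j z h1 h2
      · exact cross i j z h1 h2
      · exact (cross j i z h2 h1).symm
      · have hij := hQd _ _ z h1 h2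
        apply sinj
        rcases hσ i with h3 | h3 <;> rcases hσ j with h4 | h4
        · rw [← h3.2, ← h4.2, hij]
        · exact absurd (by rw [← h4.2, ← hij, h3.2]; exact h3.1) hvS
        · exact absurd (by rw [← h3.2, hij, h4.2]; exact h4.1) hvS
        · rw [h3.1, h4.1]

theorem exists_dipath_s17 {V : Type*} (E : V → V → Prop) (D : V → Prop) {a b : V} (hb : D b)
    (h : Relation.ReflTransGen (fun p q => E p q ∧ D p) a b) :
    ∃ l, IsDipath E a b l ∧ ∀ z ∈ l, D z := by
  induction h using Relation.ReflTransGen.head_induction_on with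
  | refl => exact ⟨[b], ⟨List.isChain_singleton b, by simp, by simp, by simp⟩, by simpa using hb⟩
  | @head p q hpq _ ih =>
    obtain ⟨l, ⟨h1, h2, h3, h4⟩, h5⟩ := ih
    by_cases hp : p ∈ l
    · obtain ⟨l1, l2, rfl⟩ := List.append_of_mem hp
      refine ⟨p :: l2, ⟨?_, by simp, ?_, ?_⟩, fun z hz => h5 z (by simp_all)⟩
      · exact (List.isChain_append.1 h1).2.1
      · rw [← h3]; simp [List.getLast?_append, List.getLast?_cons]
      · exact (List.nodup_append.1 h4).2.1
    · cases l with
      | nil => simp at h2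
      | cons c l =>
        simp at h2
        subst h2
        refine ⟨p :: c :: l, ⟨?_, by simp, ?_, ?_⟩, ?_⟩
        · exact List.isChain_cons_cons.2 ⟨hpq.1, h1⟩
        · rw [← h3]; simp
        · exact List.nodup_cons.2 ⟨hp, h4⟩
        · intro z hz
          rcases List.mem_cons.1 hz with rfl | hz
          · exact hpq.2
          · exact h5 z hz

theorem dipath_edge {V : Type*} (E : V → V → Prop) {x y : V} (hxy : x ≠ y) {l : List V}
    (h : IsDipath E x y l) (hl : ∀ z ∈ l, z = x ∨ z = y) : E x y := by
  obtain ⟨h1, h2, h3, h4⟩ := h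
  match l with
  | [] => simp at h2
  | [c] => simp at h2 h3; exact absurd (h2.symm.trans h3) hxy
  | c :: d :: l =>
    simp at h2
    subst h2
    rcases hl d (by simp) with rfl | rfl
    · simp at h4
    · exact (List.isChain_cons_cons.1 h1).1

theorem reach_of_dipath_s17 {V : Type*} (E : V → V → Prop) {y : V} (X : Set V) (l : List V) :
    ∀ x, IsDipath E x y l → (∀ z ∈ l, z ∉ X) →
    Relation.ReflTransGen (fun a b => E a b ∧ a ∉ X ∧ b ∉ X) x y := by
  induction l with
  | nil => intro x h; simp [IsDipath] at h
  | cons c l ih =>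
    rintro x ⟨h1, h2, h3, h4⟩ hX
    simp at h2
    subst h2
    cases l with
    | nil => simp at h3; subst h3; exact .refl
    | cons d l =>
      refine (ih d ⟨(List.isChain_cons_cons.1 h1).2, by simp, ?_, (List.nodup_cons.1 h4).2⟩
        (fun z hz => hX z (List.mem_cons_of_mem _ hz))).head
        ⟨(List.isChain_cons_cons.1 h1).1, hX _ (by simp), hX _ (by simp)⟩
      rw [← h3]; simp

theorem reach_of_kvdp {V : Type*} [Fintype V] (E : V → V → Prop) {k : ℕ} {x y : V}
    (h : KVDP E k x y) (X : Set V) (hx : x ∉ X) (hy : y ∉ X) (hX : X.ncard < k) :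
    DiReach (fun a b => E a b ∧ a ∉ X ∧ b ∉ X) x y := by
  obtain ⟨P, hP, hd⟩ := h
  by_cases hi : ∃ i, ∀ z ∈ P i, z ∉ X
  · obtain ⟨i, hi⟩ := hi
    exact reach_of_dipath_s17 E X (P i) x (hP i) hi
  · push Not at hi
    choose f hf hfX using hi
    have finj : Function.Injective f := by
      intro i j hij
      by_contra hne
      rcases (hd i j hne).2 (f i) (hf i) (hij ▸ hf j) with h | h
      · exact hx (h ▸ hfX i)
      · exact hy (h ▸ hfX i)
    have h1 : (Set.range f).ncard ≤ X.ncard :=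
      Set.ncard_le_ncard (by rintro _ ⟨i, rfl⟩; exact hfX i) (Set.toFinite _)
    rw [← Set.image_univ, Set.ncard_image_of_injective _ finj] at h1
    simp at h1
    omega

theorem kvdp_of_reach {V : Type*} [Fintype V] (E : V → V → Prop) {k : ℕ} {x y : V} (hxy : x ≠ y)
    (hE : ¬ E x y)
    (h : ∀ X : Set V, x ∉ X → y ∉ X → X.ncard < k →
      DiReach (fun a b => E a b ∧ a ∉ X ∧ b ∉ X) x y) : KVDP E k x y := by
  classical
  let F : Finset (V × V) := Finset.univ.filter
    (fun e => E e.1 e.2 ∧ e.1 ≠ x ∧ e.1 ≠ y ∧ e.2 ≠ x ∧ e.2 ≠ y)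
  let A : Finset V := Finset.univ.filter (fun z => E x z)
  let B : Finset V := Finset.univ.filter (fun z => E z y)
  have hF : ∀ p q, (p, q) ∈ F ↔ (E p q ∧ p ≠ x ∧ p ≠ y ∧ q ≠ x ∧ q ≠ y) := by simp [F]
  have hA : ∀ z, z ∈ A ↔ E x z := by simp [A]
  have hB : ∀ z, z ∈ B ↔ E z y := by simp [B]
  obtain ⟨a, b, C, ha, hb, hC, hd⟩ := menger_sets F k A B (by
    intro S hS
    by_contra hk
    have hr := h ((S : Set V) \ {x, y}) (by simp) (by simp) (by
      have := Set.ncard_le_ncard (s := (S : Set V) \ {x, y}) (t := S) Set.sdiff_subset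
        (Set.toFinite _)
      rw [Set.ncard_coe_finset] at this
      omega)
    have key : ∀ z, Relation.ReflTransGen (fun a b => E a b ∧ a ∉ ((S : Set V) \ {x, y}) ∧
        b ∉ ((S : Set V) \ {x, y})) x z → z = x ∨ (z ≠ x ∧ z ≠ y ∧ z ∉ S ∧ ∃ a ∈ A,
          Relation.ReflTransGen (fun p q => (p, q) ∈ F ∧ p ∉ S) a z) := by
      intro z hz
      induction hz with
      | refl => exact Or.inl rfl
      | @tail p q _ h2 ih =>
        obtain ⟨h2, h3, h4⟩ := h2
        by_cases hqx : q = x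
        · exact Or.inl hqx
        rcases ih with rfl | ⟨i1, i2, i3, c, hc, i4⟩
        · have hqy : q ≠ y := by rintro rfl; exact hE h2
          refine Or.inr ⟨hqx, hqy, ?_, q, (hA q).2 h2, .refl⟩
          simpa [hqx, hqy] using h4
        · by_cases hqy : q = y
          · subst hqy
            exact absurd (hS c hc p ((hB p).2 h2) i4) i3
          · refine Or.inr ⟨hqx, hqy, ?_, c, hc, i4.tail ⟨(hF _ _).2 ⟨h2, i1, i2, hqx, hqy⟩, i3⟩⟩
            simpa [hqx, hqy] using h4
    rcases key y hr with h1 | h1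
    · exact hxy h1.symm
    · exact h1.2.1 rfl)
  have hpath : ∀ i, ∃ l, IsDipath E x y l ∧ ∀ z ∈ l, z = x ∨ z = y ∨ z ∈ C i := by
    intro i
    apply exists_dipath_s17 E (fun z => z = x ∨ z = y ∨ z ∈ C i) (by simp)
    have h1 := ((hC i).2.2 _ (hC i).2.1).1
    have h2 : Relation.ReflTransGen (fun p q => E p q ∧ (p = x ∨ p = y ∨ p ∈ C i)) (a i) (b i) :=
      rtg_mono h1 (fun p q hpq => ⟨((hF p q).1 hpq.1).1, Or.inr (Or.inr hpq.2.1)⟩)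
    exact (h2.head ⟨(hA _).1 (ha i), Or.inl rfl⟩).tail
      ⟨(hB _).1 (hb i), Or.inr (Or.inr (hC i).2.1)⟩
  choose P hP hPC using hpath
  have hdis : ∀ i j, i ≠ j → ∀ z, z ∈ P i → z ∈ P j → z = x ∨ z = y := by
    intro i j hij z h1 h2
    rcases hPC i z h1 with h3 | h3 | h3
    · exact Or.inl h3
    · exact Or.inr h3
    · rcases hPC j z h2 with h4 | h4 | h4
      · exact Or.inl h4
      · exact Or.inr h4
      · exact absurd (hd i j z h3 h4) hij
  refine ⟨P, hP, fun i j hij => ⟨fun he => ?_, hdis i j hij⟩⟩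
  exact hE (dipath_edge E hxy (hP i) (fun z hz => hdis i j hij z hz (he ▸ hz)))

/-- Lemma A.1: `x ↔^{ks} y` iff one of the four conditions of
Menger type holds. -/
theorem stmt17 {V : Type*} [Fintype V] (E : V → V → Prop)
    (hirr : ∀ v, ¬ E v v) (k : ℕ) (hk : 1 ≤ k) (x y : V) (hxy : x ≠ y) :
    RelKs E k x y ↔
      ((E x y ∧ E y x) ∨
       (E x y ∧ ¬ E y x ∧ KVDP E k y x) ∨
       (E y x ∧ ¬ E x y ∧ KVDP E k x y) ∨
       (¬ E x y ∧ ¬ E y x ∧ KVDP E k x y ∧ KVDP E k y x)) := by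
  constructor
  · intro h
    have h1 : ¬ E x y → KVDP E k x y := fun hE =>
      kvdp_of_reach E hxy hE (fun X hx hy hX => (h X hx hy hX).1)
    have h2 : ¬ E y x → KVDP E k y x := fun hE =>
      kvdp_of_reach E hxy.symm hE (fun X hy hx hX => (h X hx hy hX).2)
    tauto
  · intro h X hx hy hX
    have h1 : E x y ∨ KVDP E k x y := by tauto
    have h2 : E y x ∨ KVDP E k y x := by tauto
    constructor
    · rcases h1 with h1 | h1
      · exact Relation.ReflTransGen.single ⟨h1, hx, hy⟩
      · exact reach_of_kvdp E h1 X hx hy hX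
    · rcases h2 with h2 | h2
      · exact Relation.ReflTransGen.single ⟨h2, hy, hx⟩
      · exact reach_of_kvdp E h2 X hy hx hX
end
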